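/- Let p ≥ 4 be an integer and let v be a simple L-periodic arc-length curve of class C⁴. Let (N₀, (s^j)_{j≥0}, (d^j)_{j≥1}) be data of the (S_p, S_{p−2}) normal multiscale transform for v which are convergent with limit s : ℝ → ℝ, and assume in addition that s^{j−1}_i ≤ s^j_K ≤ s^{j−1}_{i+p+1} whenever j ≥ 1, i ∈ ℤ and 2i ≤ K ≤ 2i + p + 2. Then s is three times continuously differentiable and, for every α ∈ (0,1), its third derivative s''' is α-Hölder continuous on every compact interval (i.e. the normal re-parametrization is C^{3,1−}). -/

import Mathlib

/-- The Lane–Riesenfeld (B-spline) subdivision operator `S p`, acting on sequences with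
values in a real vector space (componentwise averaging). -/
noncomputable def S {E : Type*} [AddCommGroup E] [Module ℝ E] : ℕ → (ℤ → E) → ℤ → E
  | 0, x, i => x (Int.fdiv i 2)
  | p + 1, x, i => (2⁻¹ : ℝ) • (S p x i + S p x (i + 1))

/-- Forward difference operator. -/
def Δ {E : Type*} [AddCommGroup E] (x : ℤ → E) : ℤ → E := fun i => x (i + 1) - x i

/-- Euclidean scalar product on `ℝ²`. -/
noncomputable def dot (u w : ℝ × ℝ) : ℝ := u.1 * w.1 + u.2 * w.2

/-- Euclidean norm on `ℝ²`. -/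
noncomputable def enorm2 (u : ℝ × ℝ) : ℝ := Real.sqrt (u.1 ^ 2 + u.2 ^ 2)

/-- Rotation by 90°: `u^⊥ = (−u₂, u₁)`. -/
def perp (u : ℝ × ℝ) : ℝ × ℝ := (-u.2, u.1)

/-- The continuous piecewise-linear interpolant of the data `x : ℤ → ℝ` on the grid
`2^{−j}ℤ`. -/
noncomputable def plin (j : ℕ) (x : ℤ → ℝ) (t : ℝ) : ℝ :=
  x ⌊(2 : ℝ) ^ j * t⌋ +
    ((2 : ℝ) ^ j * t - (⌊(2 : ℝ) ^ j * t⌋ : ℤ)) * (x (⌊(2 : ℝ) ^ j * t⌋ + 1) - x ⌊(2 : ℝ) ^ j * t⌋)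

section Subdivision

theorem S_zero {E : Type*} [AddCommGroup E] [Module ℝ E] (x : ℤ → E) (K : ℤ) :
    S 0 x K = x (K / 2) := by
  simp [S, Int.fdiv_eq_ediv_of_nonneg]

theorem S_succ {E : Type*} [AddCommGroup E] [Module ℝ E] (p : ℕ) (x : ℤ → E) (K : ℤ) :
    S (p + 1) x K = (2⁻¹ : ℝ) • (S p x K + S p x (K + 1)) := rfl

theorem S_succ_real (p : ℕ) (x : ℤ → ℝ) (K : ℤ) :
    S (p + 1) x K = (S p x K + S p x (K + 1)) / 2 := by
  rw [S_succ, smul_eq_mul]; ring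

theorem S_mul_left (p : ℕ) (c : ℝ) (x : ℤ → ℝ) (K : ℤ) :
    S p (fun i => c * x i) K = c * S p x K := by
  induction p generalizing K with
  | zero => simp [S_zero]
  | succ p ih => simp only [S_succ_real, ih]; ring

theorem S_sub (p : ℕ) (x y : ℤ → ℝ) (K : ℤ) :
    S p (fun i => x i - y i) K = S p x K - S p y K := by
  induction p generalizing K with
  | zero => simp [S_zero]
  | succ p ih => simp only [S_succ_real, ih]; ring

theorem S_const (p : ℕ) (c : ℝ) (K : ℤ) : S p (fun _ => c) K = c := by
  induction p generalizing K with
  | zero => simp [S_zero]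
  | succ p ih => simp only [S_succ_real, ih]; ring

theorem dot_S (p : ℕ) (x : ℤ → ℝ × ℝ) (w : ℝ × ℝ) (K : ℤ) :
    dot (S p x K) w = S p (fun i => dot (x i) w) K := by
  induction p generalizing K with
  | zero => simp [S_zero]
  | succ p ih =>
    rw [S_succ_real, ← ih, ← ih, S_succ]
    simp only [dot, Prod.smul_fst, Prod.smul_snd, Prod.fst_add, Prod.snd_add, smul_eq_mul]
    ring

/-- `S p x K` is monotone in the values of `x` on the stencil `[K / 2, (K + p) / 2]`. -/
theorem S_le_S (p : ℕ) (x y : ℤ → ℝ) (K : ℤ)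
    (h : ∀ l, K / 2 ≤ l → l ≤ (K + p) / 2 → x l ≤ y l) : S p x K ≤ S p y K := by
  induction p generalizing K with
  | zero => simpa [S_zero] using h (K / 2) le_rfl (by simp)
  | succ p ih =>
    have h1 := ih K fun l h1 h2 => h l h1 (by push_cast; omega)
    have h2 := ih (K + 1) fun l h1 h2 => h l (by omega) (by push_cast; omega)
    rw [S_succ_real, S_succ_real]
    linarith

theorem abs_S_le (p : ℕ) (x : ℤ → ℝ) (K : ℤ) (B : ℝ)
    (h : ∀ l, K / 2 ≤ l → l ≤ (K + p) / 2 → |x l| ≤ B) : |S p x K| ≤ B := by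
  rw [abs_le]
  constructor
  · rw [← S_const p (-B) K]
    exact S_le_S _ _ _ _ fun l h1 h2 => (abs_le.1 (h l h1 h2)).1
  · rw [← S_const p B K]
    exact S_le_S _ _ _ _ fun l h1 h2 => (abs_le.1 (h l h1 h2)).2

theorem S_add_two_sub (p : ℕ) (x : ℤ → ℝ) (K : ℤ) :
    S p x (K + 2) - S p x K = S p (Δ x) K := by
  induction p generalizing K with
  | zero =>
    have : (K + 2) / 2 = K / 2 + 1 := by omega
    simp [S_zero, Δ, this]
  | succ p ih =>
    rw [S_succ_real, S_succ_real, S_succ_real, ← ih, ← ih,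
      show K + 2 + 1 = K + 1 + 2 by ring]
    ring

theorem Δ_S_succ (p : ℕ) (x : ℤ → ℝ) :
    Δ (S (p + 1) x) = fun K => 2⁻¹ * S p (Δ x) K := by
  funext K
  rw [← S_add_two_sub, Δ, S_succ_real, S_succ_real, show K + 1 + 1 = K + 2 by ring]
  ring

theorem Δ_mul_left (c : ℝ) (x : ℤ → ℝ) : Δ (fun i => c * x i) = fun i => c * Δ x i := by
  funext i; simp only [Δ]; ring

theorem iterate_Δ_mul_left (k : ℕ) (c : ℝ) (x : ℤ → ℝ) :
    Δ^[k] (fun i => c * x i) = fun i => c * Δ^[k] x i := by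
  induction k with
  | zero => rfl
  | succ k ih =>
    rw [Function.iterate_succ_apply', ih, Δ_mul_left, Function.iterate_succ_apply']

theorem iterate_Δ_add (k : ℕ) (x y : ℤ → ℝ) :
    Δ^[k] (fun i => x i + y i) = fun i => Δ^[k] x i + Δ^[k] y i := by
  induction k with
  | zero => rfl
  | succ k ih =>
    rw [Function.iterate_succ_apply', ih, Function.iterate_succ_apply',
      Function.iterate_succ_apply']
    funext i
    simp only [Δ]; ring

theorem iterate_Δ_S (k p : ℕ) (x : ℤ → ℝ) :
    Δ^[k] (S (p + k) x) = fun K => (2⁻¹ : ℝ) ^ k * S p (Δ^[k] x) K := by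
  induction k generalizing x with
  | zero => simp
  | succ k ih =>
    rw [Function.iterate_succ_apply, ← add_assoc, Δ_S_succ, iterate_Δ_mul_left, ih,
      Function.iterate_succ_apply]
    funext K
    ring

theorem abs_iterate_Δ_le (k : ℕ) (x : ℤ → ℝ) (B : ℝ) (h : ∀ i, |x i| ≤ B) (i : ℤ) :
    |Δ^[k] x i| ≤ 2 ^ k * B := by
  induction k generalizing i with
  | zero => simpa using h i
  | succ k ih =>
    rw [Function.iterate_succ_apply']
    have h1 := abs_sub (Δ^[k] x (i + 1)) (Δ^[k] x i)
    have := ih i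
    have := ih (i + 1)
    simp only [Δ] at *
    rw [pow_succ]
    linarith

/-- Variation of a sequence over `n` steps. -/
theorem abs_sub_le_of_abs_Δ_le (x : ℤ → ℝ) (B : ℝ) (h : ∀ i, |Δ x i| ≤ B) (i : ℤ) (n : ℕ) :
    |x (i + n) - x i| ≤ n * B := by
  induction n with
  | zero => simp
  | succ n ih =>
    have h1 := h (i + n)
    have h2 := abs_add_le (Δ x (i + n)) (x (i + n) - x i)
    simp only [Δ] at h1 h2
    push_cast
    rw [← add_assoc]
    rw [show x (i + n + 1) - x i = x (i + n + 1) - x (i + n) + (x (i + n) - x i) by ring]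
    linarith

theorem abs_S_sub_le (p : ℕ) (x : ℤ → ℝ) (B : ℝ) (h : ∀ i, |Δ x i| ≤ B) (K : ℤ) :
    |S p x K - x (K / 2)| ≤ p * B := by
  have hB : 0 ≤ B := (abs_nonneg _).trans (h 0)
  rw [← S_const p (x (K / 2)) K, ← S_sub]
  refine abs_S_le _ _ _ _ fun l h1 h2 => ?_
  obtain ⟨n, rfl⟩ : ∃ n : ℕ, l = K / 2 + n := ⟨(l - K / 2).toNat, by omega⟩
  have hn : n ≤ p := by omega
  refine (abs_sub_le_of_abs_Δ_le x B h _ n).trans ?_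
  gcongr

/-- The normal field generated by `S q ∘ Δ` controls the length of the stencil. -/
theorem le_S_Δ (q : ℕ) (x : ℤ → ℝ) (hx : Monotone x) (K : ℤ) :
    (2⁻¹ : ℝ) ^ q * (x ((K + q) / 2 + 1) - x (K / 2)) ≤ S q (Δ x) K := by
  induction q generalizing K with
  | zero => simp [S_zero, Δ]
  | succ q ih =>
    have h1 := ih K
    have h2 := ih (K + 1)
    have h3 : x ((K + 1) / 2) ≤ x ((K + q) / 2 + 1) := hx (by omega)
    have h4 : 0 ≤ (2⁻¹ : ℝ) ^ q * (x ((K + q) / 2 + 1) - x ((K + 1) / 2)) := by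
      have := sub_nonneg.2 h3
      positivity
    rw [S_succ_real, pow_succ]
    rw [show K + 1 + (q : ℤ) = K + (q + 1 : ℕ) by push_cast; ring] at h2
    linarith

/-- First moment of the subdivision mask. -/
theorem S_id (q : ℕ) (K : ℤ) : S (q + 1) (fun i => (i : ℝ)) K = (2 * K + q) / 4 := by
  induction q generalizing K with
  | zero =>
    rw [S_succ_real, S_zero, S_zero]
    have h : K / 2 + (K + 1) / 2 = K := by omega
    have h' : ((K / 2 : ℤ) : ℝ) + (((K + 1) / 2 : ℤ) : ℝ) = K := by exact_mod_cast h
    rw [h']; push_cast; ring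
  | succ q ih =>
    rw [S_succ_real, ih, ih]; push_cast; ring

/-- The subdivision masks of order at least three have vanishing third central moment. -/
theorem S_cube_centered (q : ℕ) (K : ℤ) (a : ℝ) :
    S (q + 3) (fun i => ((i : ℝ) - a) ^ 3) K =
      ((2 * K + q + 2) / 4 - a) ^ 3 + 3 * ((2 * K + q + 2) / 4 - a) * ((q + 4) / 16) := by
  induction q generalizing K with
  | zero =>
    simp only [S_succ_real, S_zero]
    obtain ⟨m, rfl | rfl⟩ : ∃ m, K = 2 * m ∨ K = 2 * m + 1 := ⟨K / 2, by omega⟩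
    · rw [show (2 * m) / 2 = m by omega, show (2 * m + 1) / 2 = m by omega,
        show (2 * m + 1 + 1) / 2 = m + 1 by omega, show (2 * m + 1 + 1 + 1) / 2 = m + 1 by omega]
      push_cast; ring
    · rw [show (2 * m + 1) / 2 = m by omega,
        show (2 * m + 1 + 1) / 2 = m + 1 by omega, show (2 * m + 1 + 1 + 1) / 2 = m + 1 by omega,
        show (2 * m + 1 + 1 + 1 + 1) / 2 = m + 2 by omega]
      push_cast; ring
  | succ q ih =>
    rw [show q + 1 + 3 = q + 3 + 1 by ring, S_succ_real, ih, ih]; push_cast; ring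

end Subdivision

section Taylor

theorem abs_sub_le_of_abs_deriv_le {h h' : ℝ → ℝ} (hd : ∀ t, HasDerivAt h (h' t) t) {s₀ r B : ℝ}
    (hb : ∀ t, |t - s₀| ≤ r → |h' t| ≤ B) {t u : ℝ} (ht : |t - s₀| ≤ r) (hu : |u - s₀| ≤ r) :
    |h t - h u| ≤ B * |t - u| :=
  (convex_closedBall s₀ r).norm_image_sub_le_of_norm_hasDerivWithin_le (f := h) (f' := h')
    (fun x _ => (hd x).hasDerivWithinAt) (fun x hx => hb x hx) hu ht

theorem abs_le_pow_succ_of_abs_deriv_le {h h' : ℝ → ℝ} (hd : ∀ t, HasDerivAt h (h' t) t)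
    {s₀ M : ℝ} (hM : 0 ≤ M) (h0 : h s₀ = 0) {n : ℕ} (hb : ∀ t, |h' t| ≤ M * |t - s₀| ^ n) (t : ℝ) :
    |h t| ≤ M * |t - s₀| ^ (n + 1) := by
  have := abs_sub_le_of_abs_deriv_le hd (s₀ := s₀) (r := |t - s₀|) (B := M * |t - s₀| ^ n)
    (fun x hx => (hb x).trans (by gcongr)) (t := t) (u := s₀) le_rfl (by simp)
  rw [h0, sub_zero] at this
  rw [pow_succ, ← mul_assoc]
  exact this

/-- Taylor estimates up to order four, with constants depending only on a bound of the
derivatives. -/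
theorem taylor_estimates {F : ℕ → ℝ → ℝ} (hF : ∀ k < 4, ∀ t, HasDerivAt (F k) (F (k + 1) t) t)
    {M : ℝ} (hM : ∀ k ≤ 4, ∀ t, |F k t| ≤ M) (s₀ : ℝ) :
    (∀ t, |F 0 t - F 0 s₀ - F 1 s₀ * (t - s₀) - F 2 s₀ / 2 * (t - s₀) ^ 2
      - F 3 s₀ / 6 * (t - s₀) ^ 3| ≤ M * |t - s₀| ^ 4) ∧
    (∀ r t u, |t - s₀| ≤ r → |u - s₀| ≤ r →
      |F 0 t - F 0 u - F 1 s₀ * (t - u)| ≤ M * r * |t - u|) ∧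
    (∀ r t u, |t - s₀| ≤ r → |u - s₀| ≤ r →
      |F 0 t - F 0 u - F 1 s₀ * (t - u) - F 2 s₀ / 2 * ((t - s₀) ^ 2 - (u - s₀) ^ 2)|
        ≤ M * r ^ 2 * |t - u|) := by
  have hM0 : 0 ≤ M := (abs_nonneg _).trans (hM 0 (by norm_num) 0)
  have hid : ∀ t, HasDerivAt (fun t : ℝ => t - s₀) 1 t := fun t => (hasDerivAt_id t).sub_const s₀
  have hp2 : ∀ t, HasDerivAt (fun t : ℝ => (t - s₀) ^ 2) (2 * (t - s₀)) t := fun t => by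
    exact ((hid t).pow 2).congr_deriv (by simp)
  have hp3 : ∀ t, HasDerivAt (fun t : ℝ => (t - s₀) ^ 3) (3 * (t - s₀) ^ 2) t := fun t => by
    exact ((hid t).pow 3).congr_deriv (by simp)
  have d3 : ∀ t, |F 3 t - F 3 s₀| ≤ M * |t - s₀| ^ (0 + 1) :=
    abs_le_pow_succ_of_abs_deriv_le (h := fun t => F 3 t - F 3 s₀) (h' := F 4)
      (fun t => (hF 3 (by norm_num) t).sub_const _) hM0 (by simp)
      (fun t => by simpa using hM 4 (by norm_num) t)
  have d2 : ∀ t, |F 2 t - F 2 s₀ - F 3 s₀ * (t - s₀)| ≤ M * |t - s₀| ^ (1 + 1) :=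
    abs_le_pow_succ_of_abs_deriv_le (h := fun t => F 2 t - F 2 s₀ - F 3 s₀ * (t - s₀))
      (h' := fun t => F 3 t - F 3 s₀)
      (fun t => by
        exact (((hF 2 (by norm_num) t).sub_const (F 2 s₀)).sub
          ((hid t).const_mul (F 3 s₀))).congr_deriv (by ring))
      hM0 (by simp) d3
  have d1 : ∀ t, |F 1 t - F 1 s₀ - F 2 s₀ * (t - s₀) - F 3 s₀ / 2 * (t - s₀) ^ 2|
      ≤ M * |t - s₀| ^ (2 + 1) :=
    abs_le_pow_succ_of_abs_deriv_le
      (h := fun t => F 1 t - F 1 s₀ - F 2 s₀ * (t - s₀) - F 3 s₀ / 2 * (t - s₀) ^ 2)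
      (h' := fun t => F 2 t - F 2 s₀ - F 3 s₀ * (t - s₀))
      (fun t => by
        refine ((((hF 1 (by norm_num) t).sub_const (F 1 s₀)).sub
          ((hid t).const_mul (F 2 s₀))).sub ((hp2 t).const_mul (F 3 s₀ / 2))).congr_deriv ?_
        ring)
      hM0 (by simp) d2
  have e2 : ∀ t, |F 2 t - F 2 s₀| ≤ M * |t - s₀| ^ (0 + 1) :=
    abs_le_pow_succ_of_abs_deriv_le (h := fun t => F 2 t - F 2 s₀) (h' := F 3)
      (fun t => (hF 2 (by norm_num) t).sub_const _) hM0 (by simp)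
      (fun t => by simpa using hM 3 (by norm_num) t)
  have e1 : ∀ t, |F 1 t - F 1 s₀ - F 2 s₀ * (t - s₀)| ≤ M * |t - s₀| ^ (1 + 1) :=
    abs_le_pow_succ_of_abs_deriv_le (h := fun t => F 1 t - F 1 s₀ - F 2 s₀ * (t - s₀))
      (h' := fun t => F 2 t - F 2 s₀)
      (fun t => by
        exact (((hF 1 (by norm_num) t).sub_const (F 1 s₀)).sub
          ((hid t).const_mul (F 2 s₀))).congr_deriv (by ring))
      hM0 (by simp) e2
  have c1 : ∀ t, |F 1 t - F 1 s₀| ≤ M * |t - s₀| ^ (0 + 1) :=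
    abs_le_pow_succ_of_abs_deriv_le (h := fun t => F 1 t - F 1 s₀) (h' := F 2)
      (fun t => (hF 1 (by norm_num) t).sub_const _) hM0 (by simp)
      (fun t => by simpa using hM 2 (by norm_num) t)
  refine ⟨?_, fun r t u ht hu => ?_, fun r t u ht hu => ?_⟩
  · exact abs_le_pow_succ_of_abs_deriv_le
      (h := fun t => F 0 t - F 0 s₀ - F 1 s₀ * (t - s₀) - F 2 s₀ / 2 * (t - s₀) ^ 2
        - F 3 s₀ / 6 * (t - s₀) ^ 3)
      (h' := fun t => F 1 t - F 1 s₀ - F 2 s₀ * (t - s₀) - F 3 s₀ / 2 * (t - s₀) ^ 2)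
      (fun t => by
        refine (((((hF 0 (by norm_num) t).sub_const (F 0 s₀)).sub
          ((hid t).const_mul (F 1 s₀))).sub ((hp2 t).const_mul (F 2 s₀ / 2))).sub
          ((hp3 t).const_mul (F 3 s₀ / 6))).congr_deriv ?_
        ring)
      hM0 (by simp) d1
  · have := abs_sub_le_of_abs_deriv_le (h := fun t => F 0 t - F 1 s₀ * (t - s₀))
      (h' := fun t => F 1 t - F 1 s₀)
      (fun t => ((hF 0 (by norm_num) t).sub ((hid t).const_mul (F 1 s₀))).congr_deriv (by ring))
      (B := M * r)
      (fun x hx => (c1 x).trans (by rw [zero_add, pow_one]; gcongr)) ht hu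
    convert this using 2
    ring
  · have := abs_sub_le_of_abs_deriv_le
      (h := fun t => F 0 t - F 1 s₀ * (t - s₀) - F 2 s₀ / 2 * (t - s₀) ^ 2)
      (h' := fun t => F 1 t - F 1 s₀ - F 2 s₀ * (t - s₀))
      (fun t => by
        refine (((hF 0 (by norm_num) t).sub ((hid t).const_mul (F 1 s₀))).sub
          ((hp2 t).const_mul (F 2 s₀ / 2))).congr_deriv ?_
        ring)
      (B := M * r ^ 2)
      (fun x hx => (e1 x).trans (by rw [one_add_one_eq_two]; gcongr)) ht hu
    convert this using 2
    ring

theorem exists_bound_iteratedDeriv {φ : ℝ → ℝ} {n : ℕ} (hφ : ContDiff ℝ n φ) {L : ℝ} (hL : 0 < L)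
    (hper : Function.Periodic φ L) : ∃ M, ∀ k ≤ n, ∀ t, |iteratedDeriv k φ t| ≤ M := by
  have h : ∀ k, ∃ M, k ≤ n → ∀ t, |iteratedDeriv k φ t| ≤ M := by
    intro k
    by_cases hk : k ≤ n
    · have hc : Continuous (iteratedDeriv k φ) := hφ.continuous_iteratedDeriv k (by exact_mod_cast hk)
      obtain ⟨M, hM⟩ := isCompact_Icc.exists_bound_of_continuousOn
        (s := Set.Icc (0 : ℝ) L) hc.continuousOn
      refine ⟨M, fun _ t => ?_⟩
      have hp : Function.Periodic (iteratedDeriv k φ) L := fun x => by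
        have := congrFun (iteratedDeriv_comp_add_const k φ L) x
        rw [← this]
        congr 1
        exact funext hper
      obtain ⟨y, hy, hty⟩ := hp.exists_mem_Ico₀ hL t
      rw [hty]
      exact hM y ⟨hy.1, hy.2.le⟩
    · exact ⟨0, fun h => absurd h hk⟩
  choose M hM using h
  refine ⟨∑ k ∈ Finset.range (n + 1), |M k|, fun k hk t => (hM k hk t).trans ?_⟩
  exact (le_abs_self _).trans
    (Finset.single_le_sum (f := fun k => |M k|) (fun _ _ => abs_nonneg _)
      (Finset.mem_range.2 (by omega)))

/-- Expansion of an arc-length curve in its moving frame, uniformly in the base point. -/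
theorem exists_frame_expansion {L : ℝ} (hL : 0 < L) {v : ℝ → ℝ × ℝ} (hper : ∀ t, v (t + L) = v t)
    (hreg : ContDiff ℝ 4 v) (hunit : ∀ t, dot (deriv v t) (deriv v t) = 1) :
    ∃ M : ℝ, 1 ≤ M ∧ ∀ s₀ : ℝ, ∃ T : ℝ × ℝ, ∃ a b : ℝ, dot T T = 1 ∧ |a| ≤ M ∧ |b| ≤ M ∧
      (∀ t, |dot (v t) T - dot (v s₀) T - (t - s₀) - a * (t - s₀) ^ 3| ≤ M * |t - s₀| ^ 4) ∧
      (∀ r t u, |t - s₀| ≤ r → |u - s₀| ≤ r →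
        |dot (v t) T - dot (v u) T - (t - u)| ≤ M * r * |t - u|) ∧
      (∀ r t u, |t - s₀| ≤ r → |u - s₀| ≤ r →
        |dot (v t) (perp T) - dot (v u) (perp T) - b * ((t - s₀) ^ 2 - (u - s₀) ^ 2)|
          ≤ M * r ^ 2 * |t - u|) := by
  set X : ℝ → ℝ := fun t => (v t).1 with hX
  set Y : ℝ → ℝ := fun t => (v t).2 with hY
  have hXc : ContDiff ℝ (4 : ℕ) X := contDiff_fst.comp hreg
  have hYc : ContDiff ℝ (4 : ℕ) Y := contDiff_snd.comp hreg
  obtain ⟨A, hA⟩ := exists_bound_iteratedDeriv hXc hL (fun t => by simp [hX, hper])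
  obtain ⟨B, hB⟩ := exists_bound_iteratedDeriv hYc hL (fun t => by simp [hY, hper])
  have hX' : ∀ k < 4, ∀ t, HasDerivAt (iteratedDeriv k X) (iteratedDeriv (k + 1) X t) t := by
    intro k hk t
    rw [iteratedDeriv_succ]
    exact (hXc.differentiable_iteratedDeriv k (by exact_mod_cast hk) t).hasDerivAt
  have hY' : ∀ k < 4, ∀ t, HasDerivAt (iteratedDeriv k Y) (iteratedDeriv (k + 1) Y t) t := by
    intro k hk t
    rw [iteratedDeriv_succ]
    exact (hYc.differentiable_iteratedDeriv k (by exact_mod_cast hk) t).hasDerivAt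
  have hv : ∀ t, deriv v t = (iteratedDeriv 1 X t, iteratedDeriv 1 Y t) := by
    intro t
    have h1 : HasDerivAt X (iteratedDeriv 1 X t) t := by simpa using hX' 0 (by norm_num) t
    have h2 : HasDerivAt Y (iteratedDeriv 1 Y t) t := by simpa using hY' 0 (by norm_num) t
    exact (h1.prodMk h2).deriv
  have hA0 : 0 ≤ A := (abs_nonneg _).trans (hA 0 (by norm_num) 0)
  have hB0 : 0 ≤ B := (abs_nonneg _).trans (hB 0 (by norm_num) 0)
  have key : ∀ c e : ℝ, |c| ≤ 1 → |e| ≤ 1 → ∀ k ≤ 4, ∀ t,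
      |c * iteratedDeriv k X t + e * iteratedDeriv k Y t| ≤ A + B + 1 := by
    intro c e hc he k hk t
    have h1 := hA k hk t
    have h2 := hB k hk t
    calc _ ≤ |c * iteratedDeriv k X t| + |e * iteratedDeriv k Y t| := abs_add_le _ _
      _ ≤ 1 * A + 1 * B := by rw [abs_mul, abs_mul]; gcongr
      _ ≤ _ := by linarith
  refine ⟨A + B + 1, by linarith, fun s₀ => ?_⟩
  set x₁ := iteratedDeriv 1 X s₀ with hx₁
  set y₁ := iteratedDeriv 1 Y s₀ with hy₁
  have hu : x₁ * x₁ + y₁ * y₁ = 1 := by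
    have := hunit s₀
    rwa [hv] at this
  have hx1 : |x₁| ≤ 1 := abs_le.2 ⟨by nlinarith [mul_self_nonneg y₁], by nlinarith [mul_self_nonneg y₁]⟩
  have hy1 : |y₁| ≤ 1 := abs_le.2 ⟨by nlinarith [mul_self_nonneg x₁], by nlinarith [mul_self_nonneg x₁]⟩
  have hy1' : |-y₁| ≤ 1 := by rwa [abs_neg]
  have hcurv : x₁ * iteratedDeriv 2 X s₀ + y₁ * iteratedDeriv 2 Y s₀ = 0 := by
    have h1 := hX' 1 (by norm_num) s₀
    have h2 := hY' 1 (by norm_num) s₀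
    have h3 := (h1.mul h1).add (h2.mul h2)
    have h4 : iteratedDeriv 1 X * iteratedDeriv 1 X + iteratedDeriv 1 Y * iteratedDeriv 1 Y
        = fun _ => (1 : ℝ) := by
      funext t
      have := hunit t
      rwa [hv] at this
    rw [h4] at h3
    have h5 : iteratedDeriv 2 X s₀ * x₁ + x₁ * iteratedDeriv 2 X s₀
        + (iteratedDeriv 2 Y s₀ * y₁ + y₁ * iteratedDeriv 2 Y s₀) = 0 :=
      h3.unique (hasDerivAt_const s₀ (1 : ℝ))
    linarith
  have hder : ∀ c e : ℝ, ∀ k < 4, ∀ t,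
      HasDerivAt (fun t => c * iteratedDeriv k X t + e * iteratedDeriv k Y t)
        (c * iteratedDeriv (k + 1) X t + e * iteratedDeriv (k + 1) Y t) t := fun c e k hk t =>
    ((hX' k hk t).const_mul c).add ((hY' k hk t).const_mul e)
  obtain ⟨f1, f2, -⟩ := taylor_estimates
    (F := fun k t => x₁ * iteratedDeriv k X t + y₁ * iteratedDeriv k Y t)
    (hder _ _) (key _ _ hx1 hy1) s₀
  obtain ⟨-, -, g3⟩ := taylor_estimates
    (F := fun k t => -y₁ * iteratedDeriv k X t + x₁ * iteratedDeriv k Y t)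
    (hder _ _) (key _ _ hy1' hx1) s₀
  have b3 := key _ _ hx1 hy1 3 (by norm_num) s₀
  have b2 := key _ _ hy1' hx1 2 (by norm_num) s₀
  simp only [hcurv, ← hx₁, ← hy₁, hu, iteratedDeriv_zero] at f1 f2 g3
  have hf : ∀ t, dot (v t) (x₁, y₁) = x₁ * X t + y₁ * Y t := fun t => by
    simp only [dot, hX, hY]; ring
  have hg : ∀ t, dot (v t) (perp (x₁, y₁)) = -y₁ * X t + x₁ * Y t := fun t => by
    simp only [dot, perp, hX, hY]; ring
  refine ⟨(x₁, y₁), (x₁ * iteratedDeriv 3 X s₀ + y₁ * iteratedDeriv 3 Y s₀) / 6,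
    (-y₁ * iteratedDeriv 2 X s₀ + x₁ * iteratedDeriv 2 Y s₀) / 2, hu, ?_, ?_, ?_, ?_, ?_⟩
  rotate_left 2
  · intro t
    rw [hf, hf]
    have := f1 t
    rw [one_mul, zero_div, zero_mul, sub_zero] at this
    exact this
  · intro r t u ht hu
    rw [hf, hf]
    have := f2 r t u ht hu
    rwa [one_mul] at this
  · intro r t u ht hu
    rw [hg, hg]
    have := g3 r t u ht hu
    rw [show -y₁ * x₁ + x₁ * y₁ = 0 by ring, zero_mul, sub_zero] at this
    exact this
  · rw [abs_div, abs_of_pos (by norm_num : (0 : ℝ) < 6)]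
    linarith [abs_nonneg (x₁ * iteratedDeriv 3 X s₀ + y₁ * iteratedDeriv 3 Y s₀)]
  · rw [abs_div, abs_of_pos (by norm_num : (0 : ℝ) < 2)]
    linarith [abs_nonneg (-y₁ * iteratedDeriv 2 X s₀ + x₁ * iteratedDeriv 2 Y s₀)]

end Taylor

section LocalResidual

theorem S_mem_stencil (p : ℕ) {x : ℤ → ℝ} (hx : Monotone x) (K : ℤ) :
    x (K / 2) ≤ S p x K ∧ S p x K ≤ x ((K + p) / 2) := by
  constructor
  · rw [← S_const p (x (K / 2)) K]
    exact S_le_S _ _ _ _ fun l h1 _ => hx h1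
  · rw [← S_const p (x ((K + p) / 2)) K]
    exact S_le_S _ _ _ _ fun l _ h2 => hx h2

/-- If the second differences are small, the stencil of `S p` is nearly equispaced and the
cubic and quadratic moments nearly cancel. -/
theorem stencil_moment_bounds (r : ℕ) {x : ℤ → ℝ} (hx : StrictMono x) (K : ℤ) {δ₂ : ℝ}
    (h₂ : ∀ i, |Δ^[2] x i| ≤ δ₂) {s₀ R : ℝ} (hs₀ : s₀ = S (r + 3) x K)
    (hR : R = x ((K + (r + 3 : ℕ)) / 2) - x (K / 2)) :
    |S (r + 3) (fun i => (x i - s₀) ^ 3) K| ≤ 6 * (r + 3) ^ 4 * (R ^ 2 * δ₂) ∧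
    |S (r + 1) (Δ fun i => (x i - s₀) ^ 2) K| ≤ 6 * (r + 3) ^ 4 * (R * δ₂) := by
  have hδ : 0 ≤ δ₂ := (abs_nonneg _).trans (h₂ 0)
  set i₀ := K / 2 with hi₀
  set i₁ := (K + (r + 3 : ℕ)) / 2 with hi₁
  set P : ℝ := r + 3 with hP
  have hP1 : 1 ≤ P := by rw [hP]; linarith [(Nat.cast_nonneg r : (0 : ℝ) ≤ r)]
  set h := Δ x i₀ with hh
  have h01 : i₀ + 1 ≤ i₁ := by omega
  have hpos : 0 < h := by
    rw [hh]; simp only [Δ]; linarith [hx (show i₀ < i₀ + 1 by omega)]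
  have hhR : h ≤ R := by
    have := hx.monotone h01
    rw [hh, hR]; simp only [Δ]; linarith
  have hR0 : 0 < R := hpos.trans_le hhR
  have hD : ∀ n : ℕ, |Δ x (i₀ + n) - h| ≤ n * δ₂ :=
    abs_sub_le_of_abs_Δ_le (Δ x) δ₂ (fun i => h₂ i) i₀
  have hy : ∀ n : ℕ, |x (i₀ + n) - x i₀ - n * h| ≤ (n : ℝ) ^ 2 * δ₂ := by
    intro n
    induction n with
    | zero => simp
    | succ n ih =>
      have h1 := abs_add_le (x (i₀ + n) - x i₀ - n * h) (Δ x (i₀ + n) - h)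
      have h2 := hD n
      have h3 : x (i₀ + (n + 1 : ℕ)) - x i₀ - (n + 1 : ℕ) * h
          = x (i₀ + n) - x i₀ - n * h + (Δ x (i₀ + n) - h) := by
        simp only [Δ]; push_cast; rw [add_assoc]; ring
      rw [h3]
      push_cast
      nlinarith [(Nat.cast_nonneg n : (0 : ℝ) ≤ n)]
  set c : ℝ := (2 * K + r + 2) / 4 with hc
  set e : ℤ → ℝ := fun i => x i - s₀ - h * (i - c) with he
  have hstencil : ∀ l, i₀ ≤ l → l ≤ i₁ → ∃ n : ℕ, l = i₀ + n ∧ (n : ℝ) ≤ P := by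
    intro l h1 h2
    refine ⟨(l - i₀).toNat, by omega, ?_⟩
    have : (l - i₀).toNat ≤ r + 3 := by omega
    rw [hP]; exact_mod_cast this
  have hSid : S (r + 3) (fun i => (i : ℝ)) K = c := by
    rw [S_id, hc]; push_cast; ring
  have hSe : S (r + 3) e K = 0 := by
    rw [he, S_sub, S_sub, S_const, S_mul_left, S_sub, S_const, hSid, hs₀]; ring
  have hee : ∀ l, i₀ ≤ l → l ≤ i₁ → |e l - e i₀| ≤ P ^ 2 * δ₂ := by
    intro l h1 h2
    obtain ⟨n, rfl, hn⟩ := hstencil l h1 h2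
    have : e (i₀ + n) - e i₀ = x (i₀ + n) - x i₀ - n * h := by
      simp only [he]; push_cast; ring
    rw [this]
    exact (hy n).trans (by gcongr)
  have he0 : |e i₀| ≤ P ^ 2 * δ₂ := by
    have := abs_S_le (r + 3) (fun l => e l - e i₀) K (P ^ 2 * δ₂) hee
    rwa [S_sub, S_const, hSe, zero_sub, abs_neg] at this
  have heb : ∀ l, i₀ ≤ l → l ≤ i₁ → |e l| ≤ 2 * P ^ 2 * δ₂ := by
    intro l h1 h2
    have h3 := hee l h1 h2
    have h4 := abs_add_le (e l - e i₀) (e i₀)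
    rw [sub_add_cancel] at h4
    linarith
  have hmem := S_mem_stencil (r + 3) hx.monotone K
  rw [← hs₀] at hmem
  have hσ : ∀ l, i₀ ≤ l → l ≤ i₁ → |x l - s₀| ≤ R := by
    intro l h1 h2
    have h3 := hx.monotone h1
    have h4 := hx.monotone h2
    rw [abs_le, hR]
    constructor <;> linarith [hmem.1, hmem.2]
  have hτ : ∀ l : ℤ, i₀ ≤ l → l ≤ i₁ → |h * (l - c)| ≤ P * R := by
    intro l h1 h2
    rw [abs_mul, abs_of_pos hpos, mul_comm P]
    have h3 : K - 1 ≤ 2 * l := by omega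
    have h4 : 2 * l ≤ K + r + 3 := by omega
    have h3' : (K : ℝ) - 1 ≤ 2 * l := by exact_mod_cast h3
    have h4' : (2 : ℝ) * l ≤ K + r + 3 := by exact_mod_cast h4
    have h5 : |(l : ℝ) - c| ≤ P := by
      rw [abs_le, hc, hP]
      constructor <;> linarith [(Nat.cast_nonneg r : (0 : ℝ) ≤ r)]
    gcongr
  constructor
  · have h0 : S (r + 3) (fun i : ℤ => (h * (i - c)) ^ 3) K = 0 := by
      simp only [mul_pow]
      rw [S_mul_left, S_cube_centered, hc]; ring
    rw [← sub_zero (S (r + 3) (fun i => (x i - s₀) ^ 3) K), ← h0, ← S_sub]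
    refine abs_S_le _ _ _ _ fun l h1 h2 => ?_
    have h3 : (x l - s₀) ^ 3 - (h * (l - c)) ^ 3 = e l * ((x l - s₀) * (x l - s₀)
        + (x l - s₀) * (h * (l - c)) + (h * (l - c)) * (h * (l - c))) := by
      simp only [he]; ring
    have h4 := hσ l h1 h2
    have h5 := hτ l h1 h2
    have h6 : |(x l - s₀) * (x l - s₀) + (x l - s₀) * (h * (l - c))
        + (h * (l - c)) * (h * (l - c))| ≤ R * R + R * (P * R) + (P * R) * (P * R) := by
      refine (abs_add_three _ _ _).trans ?_
      rw [abs_mul, abs_mul (x l - s₀), abs_mul (h * (l - c))]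
      gcongr
    rw [h3, abs_mul]
    calc |e l| * _ ≤ (2 * P ^ 2 * δ₂) * (R * R + R * (P * R) + (P * R) * (P * R)) := by
          have := heb l h1 h2
          gcongr
      _ ≤ (2 * P ^ 2 * δ₂) * (P ^ 2 * (R * R) + P ^ 2 * (R * R) + P ^ 2 * (R * R)) := by
          have h7 : 1 ≤ P ^ 2 := one_le_pow₀ hP1
          have h8 : P ≤ P ^ 2 := by nlinarith
          have h9 : 0 ≤ R * R := by positivity
          have h10 : R * R ≤ P ^ 2 * (R * R) := le_mul_of_one_le_left h9 h7
          have h11 : R * (P * R) ≤ P ^ 2 * (R * R) := by nlinarith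
          have h12 : (P * R) * (P * R) = P ^ 2 * (R * R) := by ring
          exact mul_le_mul_of_nonneg_left (by linarith) (by positivity)
      _ = _ := by ring
  · have h0 : S (r + 1) (Δ fun i : ℤ => (h * (i - c)) ^ 2) K = 0 := by
      have : (Δ fun i : ℤ => (h * (i - c)) ^ 2) = fun i : ℤ => h ^ 2 * (2 * (i : ℝ) - (2 * c - 1)) := by
        funext i; simp only [Δ]; push_cast; ring
      rw [this, S_mul_left, S_sub, S_const, S_mul_left, S_id, hc]; ring
    rw [← sub_zero (S (r + 1) (Δ fun i => (x i - s₀) ^ 2) K), ← h0, ← S_sub]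
    refine abs_S_le _ _ _ _ fun l h1 h2 => ?_
    have h2' : l + 1 ≤ i₁ := by omega
    have h3 : Δ (fun i => (x i - s₀) ^ 2) l - Δ (fun i : ℤ => (h * (i - c)) ^ 2) l
        = (Δ x l - h) * ((x l - s₀) + (x (l + 1) - s₀)) + h * (e l + e (l + 1)) := by
      simp only [he, Δ]; push_cast; ring
    have hD' : |Δ x l - h| ≤ P * δ₂ := by
      obtain ⟨n, rfl, hn⟩ := hstencil l h1 (by omega)
      exact (hD n).trans (by gcongr)
    have h4 : |(x l - s₀) + (x (l + 1) - s₀)| ≤ R + R :=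
      (abs_add_le _ _).trans (add_le_add (hσ l h1 (by omega)) (hσ (l + 1) (by omega) h2'))
    have h5 : |e l + e (l + 1)| ≤ 2 * P ^ 2 * δ₂ + 2 * P ^ 2 * δ₂ :=
      (abs_add_le _ _).trans (add_le_add (heb l h1 (by omega)) (heb (l + 1) (by omega) h2'))
    rw [h3]
    refine (abs_add_le _ _).trans ?_
    rw [abs_mul, abs_mul, abs_of_pos hpos]
    have h6 : P ≤ P ^ 4 := le_self_pow₀ hP1 (by norm_num)
    have h7 : P ^ 2 ≤ P ^ 4 := pow_le_pow_right₀ hP1 (by norm_num)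
    calc _ ≤ (P * δ₂) * (R + R) + R * (2 * P ^ 2 * δ₂ + 2 * P ^ 2 * δ₂) := by gcongr
      _ = (2 * P + 4 * P ^ 2) * (R * δ₂) := by ring
      _ ≤ _ := by gcongr; linarith

theorem abs_le_of_orthogonality {η R G c M a fy P gy Q wT wN σ₃ q : ℝ} (hR : 0 < R) (hc : 0 < c)
    (hc1 : c ≤ 1) (hM : 1 ≤ M) (ha : |a| ≤ M) (hfy : |fy - η| ≤ |η| / 2)
    (hP : |P - a * σ₃| ≤ M * R ^ 4)
    (hgy : |gy| ≤ 2 * M * η ^ 2) (hQ : |Q| ≤ 2 * M * R ^ 2) (hwT : c * R / 2 ≤ wT)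
    (hwN : |wN| ≤ M * (|q| + R ^ 3)) (hq : |q| ≤ 2 * R ^ 2) (hηG : |η| ≤ G) (hRG : R ≤ G)
    (hG1 : G ≤ 1) (hG : 48 * M ^ 2 * G ^ 2 ≤ c)
    (horth : (fy - P) * wT + (gy - Q) * wN = 0) :
    |η| ≤ 20 * M ^ 2 / c * (|σ₃| + R * |q| + R ^ 4) := by
  have hG0 : 0 < G := hR.trans_le hRG
  have h1 : |fy - P| * (c * R / 2) ≤ 2 * M * (η ^ 2 + R ^ 2) * (M * (|q| + R ^ 3)) := by
    calc |fy - P| * (c * R / 2) ≤ |fy - P| * |wT| := by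
          gcongr; exact hwT.trans (le_abs_self _)
      _ = |gy - Q| * |wN| := by
          rw [← abs_mul, ← abs_mul, eq_neg_of_add_eq_zero_left horth, abs_neg]
      _ ≤ _ := by
          have : |gy - Q| ≤ 2 * M * (η ^ 2 + R ^ 2) := (abs_sub _ _).trans (by linarith)
          gcongr
  have h2 : η ^ 2 * (|q| + R ^ 3) ≤ 3 * G ^ 2 * |η| * R := by
    have h3 : R ^ 3 ≤ R ^ 2 := by nlinarith [sq_nonneg R]
    calc η ^ 2 * (|q| + R ^ 3) ≤ η ^ 2 * (3 * R ^ 2) := by gcongr; linarith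
      _ = |η| * |η| * (3 * R * R) := by rw [← sq_abs]; ring
      _ ≤ |η| * G * (3 * G * R) := by gcongr
      _ = _ := by ring
  have h3 : |fy - P| * (c / 2) ≤ 2 * M ^ 2 * (3 * G ^ 2 * |η| + R * |q| + R ^ 4) := by
    refine le_of_mul_le_mul_right ?_ hR
    have : 2 * M ^ 2 * (η ^ 2 * (|q| + R ^ 3)) ≤ 2 * M ^ 2 * (3 * G ^ 2 * |η| * R) := by gcongr
    nlinarith
  have h4 : |η| / 2 - M * |σ₃| - M * R ^ 4 ≤ |fy - P| := by
    have h5 : |P| ≤ M * |σ₃| + M * R ^ 4 := by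
      have h6 := abs_add_le (P - a * σ₃) (a * σ₃)
      rw [sub_add_cancel, abs_mul] at h6
      have h7 : |a| * |σ₃| ≤ M * |σ₃| := by gcongr
      linarith
    have h8 := abs_add_three (η - fy) (fy - P) P
    rw [show η - fy + (fy - P) + P = η by ring, abs_sub_comm η fy] at h8
    linarith
  have h5 : M ≤ M ^ 2 := by nlinarith
  have h6 : (|η| / 2 - M * |σ₃| - M * R ^ 4) * (c / 2) ≤ |fy - P| * (c / 2) := by gcongr
  have h7 : 48 * M ^ 2 * G ^ 2 * |η| ≤ c * |η| := by gcongr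
  have h8 : c * M * (|σ₃| + R ^ 4) ≤ M ^ 2 * (|σ₃| + R ^ 4) := by
    gcongr; nlinarith
  have h9 : 0 ≤ M ^ 2 * |σ₃| := by positivity
  have h10 : 0 ≤ M ^ 2 * (R * |q|) := by positivity
  have h11 : 0 ≤ M ^ 2 * R ^ 4 := by positivity
  rw [div_mul_eq_mul_div, le_div_iff₀ hc]
  nlinarith

theorem dot_eq_frame {T : ℝ × ℝ} (hT : dot T T = 1) (u w : ℝ × ℝ) :
    dot u w = dot u T * dot w T + dot u (perp T) * dot w (perp T) := by
  simp only [dot, perp] at *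
  linear_combination (-(u.1 * w.1 + u.2 * w.2)) * hT

theorem dot_sub_left (u w T : ℝ × ℝ) : dot (u - w) T = dot u T - dot w T := by
  simp only [dot, Prod.fst_sub, Prod.snd_sub]; ring

/-- A point of the curve that is orthogonal to the generated normal field differs from the linear
prediction only by higher order terms. -/
theorem exists_residual_bound (r : ℕ) {L : ℝ} (hL : 0 < L) {v : ℝ → ℝ × ℝ}
    (hper : ∀ t, v (t + L) = v t) (hreg : ContDiff ℝ 4 v)
    (hunit : ∀ t, dot (deriv v t) (deriv v t) = 1) :
    ∃ C G₀ : ℝ, 0 ≤ C ∧ 0 < G₀ ∧ ∀ (x : ℤ → ℝ) (_ : StrictMono x) (K : ℤ) (y G δ₂ : ℝ),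
      (∀ i, |Δ^[2] x i| ≤ δ₂) → G ≤ G₀ → |y - S (r + 3) x K| ≤ G →
      x ((K + (r + 3 : ℕ)) / 2) - x (K / 2) ≤ G →
      dot (v y - S (r + 3) (fun k => v (x k)) K) (S (r + 1) (Δ fun k => v (x k)) K) = 0 →
      |y - S (r + 3) x K| ≤ C * (G ^ 2 * (δ₂ + G ^ 2)) := by
  obtain ⟨M, hM, hexp⟩ := exists_frame_expansion hL hper hreg hunit
  set c : ℝ := (2⁻¹ : ℝ) ^ (r + 1) with hc
  have hc0 : 0 < c := by positivity
  have hc1 : c ≤ 1 := pow_le_one₀ (by norm_num) (by norm_num)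
  refine ⟨20 * M ^ 2 / c * (12 * (r + 3) ^ 4), c / (48 * M ^ 2), by positivity, by positivity, ?_⟩
  intro x hx K y G δ₂ h₂ hG hyG hRG horth
  set s₀ := S (r + 3) x K with hs₀
  set R := x ((K + (r + 3 : ℕ)) / 2) - x (K / 2) with hR
  obtain ⟨T, a, b, hT, ha, hb, f1, f2, g2⟩ := hexp s₀
  have hδ : 0 ≤ δ₂ := (abs_nonneg _).trans (h₂ 0)
  have hM2 : 1 ≤ M ^ 2 := one_le_pow₀ hM
  have hR0 : 0 < R := by
    rw [hR]
    exact sub_pos.2 (hx (by omega))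
  have hG0 : 0 < G := hR0.trans_le hRG
  have hG' : G * (48 * M ^ 2) ≤ c := (le_div_iff₀ (by positivity)).1 hG
  have hG1 : G * 48 ≤ 1 := by nlinarith
  have hMG : M * G ≤ 1 / 2 := by nlinarith
  have hmem := S_mem_stencil (r + 3) hx.monotone K
  rw [← hs₀] at hmem
  have hσ : ∀ l, K / 2 ≤ l → l ≤ (K + (r + 3 : ℕ)) / 2 → |x l - s₀| ≤ R := by
    intro l h1 h2
    have h3 := hx.monotone h1
    have h4 := hx.monotone h2
    rw [abs_le, hR]
    constructor <;> linarith [hmem.1, hmem.2]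
  have hΔ0 : ∀ l, 0 < Δ x l := fun l => sub_pos.2 (hx (by omega))
  have hΔR : ∀ l, K / 2 ≤ l → l ≤ (K + (r + 1 : ℕ)) / 2 → Δ x l ≤ R := by
    intro l h1 h2
    have h3 := hx.monotone h1
    have h4 := hx.monotone (show l + 1 ≤ (K + (r + 3 : ℕ)) / 2 by push_cast at h2 ⊢; omega)
    simp only [Δ]
    rw [hR]; linarith
  set f : ℝ → ℝ := fun t => dot (v t) T with hf
  set g : ℝ → ℝ := fun t => dot (v t) (perp T) with hg
  set σ₃ := S (r + 3) (fun i => (x i - s₀) ^ 3) K with hσ₃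
  set q := S (r + 1) (Δ fun i => (x i - s₀) ^ 2) K with hq
  obtain ⟨m1, m2⟩ := stencil_moment_bounds r hx K h₂ hs₀ hR
  have hgquad : ∀ t, |t - s₀| ≤ 1 → |g t - g s₀| ≤ 2 * M * (t - s₀) ^ 2 := by
    intro t ht
    have h1 := g2 |t - s₀| t s₀ le_rfl (by simp)
    have h2 : |b * ((t - s₀) ^ 2 - (s₀ - s₀) ^ 2)| ≤ M * (t - s₀) ^ 2 := by
      rw [sub_self, abs_mul]; simp only [ne_eq, OfNat.ofNat_ne_zero, not_false_eq_true, zero_pow,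
        sub_zero, abs_pow, sq_abs]; gcongr
    have h3 := abs_add_le (g t - g s₀ - b * ((t - s₀) ^ 2 - (s₀ - s₀) ^ 2))
      (b * ((t - s₀) ^ 2 - (s₀ - s₀) ^ 2))
    rw [sub_add_cancel] at h3
    have h4 : M * |t - s₀| ^ 2 * |t - s₀| ≤ M * (t - s₀) ^ 2 * 1 := by
      rw [sq_abs]; gcongr
    linarith
  have main : |y - s₀| ≤ 20 * M ^ 2 / c * (|σ₃| + R * |q| + R ^ 4) := by
    refine abs_le_of_orthogonality (G := G) (a := a) (fy := f y - f s₀)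
      (P := S (r + 3) (fun i => f (x i)) K - f s₀)
      (gy := g y - g s₀) (Q := S (r + 3) (fun i => g (x i)) K - g s₀)
      (wT := S (r + 1) (Δ fun i => f (x i)) K) (wN := S (r + 1) (Δ fun i => g (x i)) K)
      hR0 hc0 hc1 hM ha ?_ ?_ ?_ ?_ ?_ ?_ ?_ hyG hRG (by linarith) ?_ ?_
    · have h1 := f2 G y s₀ hyG (by simpa using hG0.le)
      have h2 : M * G * |y - s₀| ≤ 1 / 2 * |y - s₀| := by gcongr
      exact h1.trans (by linarith)
    · have h1 : S (r + 3) (fun i => f (x i)) K - f s₀ - a * σ₃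
          = S (r + 3) (fun i => f (x i) - f s₀ - (x i - s₀) - a * (x i - s₀) ^ 3) K := by
        rw [S_sub, S_sub, S_sub, S_sub, S_const, S_const, S_mul_left, ← hs₀, ← hσ₃]; ring
      rw [h1]
      refine abs_S_le _ _ _ _ fun l h1 h2 => (f1 (x l)).trans ?_
      have := hσ l h1 h2
      gcongr
    · exact hgquad y (hyG.trans (by linarith))
    · have h1 : S (r + 3) (fun i => g (x i)) K - g s₀ = S (r + 3) (fun i => g (x i) - g s₀) K := by
        rw [S_sub, S_const]
      rw [h1]
      refine abs_S_le _ _ _ _ fun l h1 h2 => ?_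
      have h3 := hσ l h1 h2
      refine (hgquad (x l) (by linarith)).trans ?_
      rw [← sq_abs]
      gcongr
    · have h1 := le_S_Δ (r + 1) x hx.monotone K
      rw [← hc, show (K + ((r + 1 : ℕ) : ℤ)) / 2 + 1 = (K + ((r + 3 : ℕ) : ℤ)) / 2 by
        push_cast; omega, ← hR] at h1
      have h2 : S (r + 1) (fun i => 2⁻¹ * Δ x i) K ≤ S (r + 1) (Δ fun i => f (x i)) K := by
        refine S_le_S _ _ _ _ fun l h3 h4 => ?_
        have h5 := f2 R (x (l + 1)) (x l) (hσ _ (by omega) (by push_cast at h4 ⊢; omega))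
          (hσ _ h3 (by push_cast at h4 ⊢; omega))
        have h6 := hΔ0 l
        have h7 : M * R ≤ 1 / 2 := by nlinarith
        simp only [Δ] at h6 ⊢
        rw [abs_of_pos h6] at h5
        have h8 := (abs_le.1 h5).1
        have h9 : M * R * (x (l + 1) - x l) ≤ 1 / 2 * (x (l + 1) - x l) := by gcongr
        simp only [hf]
        linarith
      rw [S_mul_left] at h2
      linarith
    · have h1 : |S (r + 1) (Δ fun i => g (x i)) K - b * q| ≤ M * R ^ 3 := by
        rw [hq, ← S_mul_left, ← S_sub]
        refine abs_S_le _ _ _ _ fun l h3 h4 => ?_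
        have h5 := g2 R (x (l + 1)) (x l) (hσ _ (by omega) (by push_cast at h4 ⊢; omega))
          (hσ _ h3 (by push_cast at h4 ⊢; omega))
        refine h5.trans ?_
        have h6 := hΔR l h3 h4
        have h7 := hΔ0 l
        simp only [Δ] at h6 h7
        rw [abs_of_pos h7, pow_succ R 2, ← mul_assoc]
        gcongr
      have h2 := abs_add_le (S (r + 1) (Δ fun i => g (x i)) K - b * q) (b * q)
      rw [sub_add_cancel, abs_mul] at h2
      have h3 : |b| * |q| ≤ M * |q| := by gcongr
      linarith
    · refine abs_S_le _ _ _ _ fun l h3 h4 => ?_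
      have h5 : Δ (fun i => (x i - s₀) ^ 2) l = Δ x l * ((x (l + 1) - s₀) + (x l - s₀)) := by
        simp only [Δ]; ring
      have h6 := hσ (l + 1) (by omega) (by push_cast at h4 ⊢; omega)
      have h7 := hσ l h3 (by push_cast at h4 ⊢; omega)
      have h8 : |(x (l + 1) - s₀) + (x l - s₀)| ≤ R + R := (abs_add_le _ _).trans (add_le_add h6 h7)
      have h9 := hΔR l h3 h4
      rw [h5, abs_mul, abs_of_pos (hΔ0 l)]
      calc _ ≤ R * (R + R) := by gcongr
        _ = _ := by ring
    · nlinarith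
    · rw [dot_eq_frame hT, dot_sub_left, dot_sub_left, dot_S, dot_S, dot_S, dot_S] at horth
      have e1 : (fun i => dot (Δ (fun k => v (x k)) i) T) = Δ fun i => f (x i) := by
        funext i; simp only [Δ, dot_sub_left, hf]
      have e2 : (fun i => dot (Δ (fun k => v (x k)) i) (perp T)) = Δ fun i => g (x i) := by
        funext i; simp only [Δ, dot_sub_left, hg]
      rw [e1, e2] at horth
      rw [← horth]
      ring
  refine main.trans ?_
  rw [mul_assoc]
  have h1 : R * |q| ≤ R * (6 * (r + 3) ^ 4 * (R * δ₂)) := by gcongr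
  have h2 : (1 : ℝ) ≤ (r + 3) ^ 4 :=
    one_le_pow₀ (by linarith [(Nat.cast_nonneg r : (0 : ℝ) ≤ r)])
  have h3 : R ^ 4 ≤ 12 * (r + 3) ^ 4 * R ^ 4 :=
    le_mul_of_one_le_left (by positivity) (by linarith)
  have h4 : |σ₃| + R * |q| + R ^ 4 ≤ 12 * (r + 3) ^ 4 * (R ^ 2 * (δ₂ + R ^ 2)) := by
    calc _ ≤ 6 * (r + 3) ^ 4 * (R ^ 2 * δ₂) + R * (6 * (r + 3) ^ 4 * (R * δ₂))
        + 12 * (r + 3) ^ 4 * R ^ 4 := by linarith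
      _ = _ := by ring
  refine mul_le_mul_of_nonneg_left (h4.trans ?_) (by positivity)
  gcongr

end LocalResidual

section DyadicLimits

open Filter Topology

theorem floor_two_pow_succ_div (j : ℕ) (t : ℝ) :
    ⌊(2 : ℝ) ^ (j + 1) * t⌋ / 2 = ⌊(2 : ℝ) ^ j * t⌋ := by
  have h1 := Int.floor_le ((2 : ℝ) ^ j * t)
  have h2 := Int.lt_floor_add_one ((2 : ℝ) ^ j * t)
  have h3 : 2 * ⌊(2 : ℝ) ^ j * t⌋ ≤ ⌊(2 : ℝ) ^ (j + 1) * t⌋ := by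
    rw [Int.le_floor, pow_succ]; push_cast; linarith
  have h4 : ⌊(2 : ℝ) ^ (j + 1) * t⌋ < 2 * ⌊(2 : ℝ) ^ j * t⌋ + 2 := by
    rw [Int.floor_lt, pow_succ]; push_cast; linarith
  omega

theorem exists_dyadic_limit {z : ℕ → ℤ → ℝ} {C θ : ℝ} (hθ : θ < 1)
    (hz : ∀ j K, |z (j + 1) K - z j (K / 2)| ≤ C * θ ^ j) :
    ∃ F : ℝ → ℝ, ∀ j t, |F t - z j ⌊(2 : ℝ) ^ j * t⌋| ≤ C * θ ^ j / (1 - θ) := by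
  have h : ∀ t : ℝ, ∃ a, ∀ j, |a - z j ⌊(2 : ℝ) ^ j * t⌋| ≤ C * θ ^ j / (1 - θ) := by
    intro t
    have hd : ∀ j, dist (z j ⌊(2 : ℝ) ^ j * t⌋) (z (j + 1) ⌊(2 : ℝ) ^ (j + 1) * t⌋)
        ≤ C * θ ^ j := by
      intro j
      rw [dist_comm, Real.dist_eq]
      have := hz j ⌊(2 : ℝ) ^ (j + 1) * t⌋
      rwa [floor_two_pow_succ_div] at this
    obtain ⟨a, ha⟩ := cauchySeq_tendsto_of_complete (cauchySeq_of_le_geometric θ C hθ hd)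
    refine ⟨a, fun j => ?_⟩
    have := dist_le_of_le_geometric_of_tendsto θ C hθ hd ha j
    rwa [dist_comm, Real.dist_eq] at this
  choose F hF using h
  exact ⟨F, fun j t => hF t j⟩

theorem abs_sub_le_of_floor_close {z : ℤ → ℝ} {B : ℝ} (hz : ∀ i, |Δ z i| ≤ B) {j : ℕ} {t u : ℝ}
    (h : |t - u| ≤ (2⁻¹ : ℝ) ^ j) :
    |z ⌊(2 : ℝ) ^ j * t⌋ - z ⌊(2 : ℝ) ^ j * u⌋| ≤ B := by
  wlog htu : u ≤ t generalizing t u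
  · rw [abs_sub_comm]
    exact this (by rwa [abs_sub_comm]) (le_of_not_ge htu)
  rw [abs_of_nonneg (sub_nonneg.2 htu)] at h
  have hp : (0 : ℝ) < 2 ^ j := by positivity
  have h1 : (2 : ℝ) ^ j * t ≤ 2 ^ j * u + 1 := by
    have := mul_le_mul_of_nonneg_left h hp.le
    rw [inv_pow, mul_inv_cancel₀ hp.ne'] at this
    linarith
  have h2 : ⌊(2 : ℝ) ^ j * u⌋ ≤ ⌊(2 : ℝ) ^ j * t⌋ := Int.floor_le_floor (by gcongr)
  have h3 : ⌊(2 : ℝ) ^ j * t⌋ ≤ ⌊(2 : ℝ) ^ j * u⌋ + 1 := by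
    rw [← Int.floor_add_one]; exact Int.floor_le_floor h1
  have hB : 0 ≤ B := (abs_nonneg _).trans (hz 0)
  obtain h4 | h4 : ⌊(2 : ℝ) ^ j * t⌋ = ⌊(2 : ℝ) ^ j * u⌋ ∨
    ⌊(2 : ℝ) ^ j * t⌋ = ⌊(2 : ℝ) ^ j * u⌋ + 1 := by omega
  · rw [h4]; simpa using hB
  · rw [h4]; exact hz _

theorem dyadic_limit_modulus {z : ℕ → ℤ → ℝ} {C D θ : ℝ} (hΔ : ∀ j i, |Δ (z j) i| ≤ C * θ ^ j)
    {F : ℝ → ℝ} (hF : ∀ j t, |F t - z j ⌊(2 : ℝ) ^ j * t⌋| ≤ D * θ ^ j) (j : ℕ) (t u : ℝ)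
    (h : |t - u| ≤ (2⁻¹ : ℝ) ^ j) : |F t - F u| ≤ (2 * D + C) * θ ^ j := by
  have h1 := hF j t
  have h2 := hF j u
  have h3 := abs_sub_le_of_floor_close (hΔ j) h
  rw [abs_sub_comm] at h2
  have h4 := abs_add_three (F t - z j ⌊(2 : ℝ) ^ j * t⌋)
    (z j ⌊(2 : ℝ) ^ j * t⌋ - z j ⌊(2 : ℝ) ^ j * u⌋) (z j ⌊(2 : ℝ) ^ j * u⌋ - F u)
  rw [show F t - z j ⌊(2 : ℝ) ^ j * t⌋ + (z j ⌊(2 : ℝ) ^ j * t⌋ - z j ⌊(2 : ℝ) ^ j * u⌋)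
    + (z j ⌊(2 : ℝ) ^ j * u⌋ - F u) = F t - F u by ring] at h4
  linarith

theorem continuous_of_dyadic_modulus {F : ℝ → ℝ} {C θ : ℝ} (h0 : 0 ≤ θ) (h1 : θ < 1)
    (h : ∀ (j : ℕ) (t u : ℝ), |t - u| ≤ (2⁻¹ : ℝ) ^ j → |F t - F u| ≤ C * θ ^ j) :
    Continuous F := by
  rw [Metric.continuous_iff]
  intro b ε hε
  have ht : Tendsto (fun j : ℕ => C * θ ^ j) atTop (𝓝 0) := by
    simpa using (tendsto_pow_atTop_nhds_zero_of_lt_one h0 h1).const_mul C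
  obtain ⟨j, hj⟩ := (ht.eventually (gt_mem_nhds hε)).exists
  exact ⟨(2⁻¹ : ℝ) ^ j, by positivity, fun a ha => (h j a b ha.le).trans_lt hj⟩

theorem holder_of_dyadic_modulus {F : ℝ → ℝ} {C α : ℝ} (hC : 0 ≤ C) (hα : 0 < α)
    (h : ∀ (j : ℕ) (t u : ℝ), |t - u| ≤ (2⁻¹ : ℝ) ^ j → |F t - F u| ≤ C * ((2⁻¹ : ℝ) ^ α) ^ j)
    {t u : ℝ} (htu : |t - u| ≤ 1) : |F t - F u| ≤ C * 2 ^ α * |t - u| ^ α := by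
  rcases (abs_nonneg (t - u)).eq_or_lt with h0 | h0
  · have : t = u := by rw [← sub_eq_zero]; exact abs_eq_zero.1 h0.symm
    subst this
    simp [Real.zero_rpow hα.ne']
  obtain ⟨j, hj1, hj2⟩ := exists_nat_pow_near_of_lt_one h0 htu
    (by norm_num : (0 : ℝ) < 2⁻¹) (by norm_num)
  refine (h j t u hj2).trans ?_
  rw [mul_assoc]
  refine mul_le_mul_of_nonneg_left ?_ hC
  have h1 : ((2⁻¹ : ℝ) ^ α) ^ j = 2 ^ α * ((2⁻¹ : ℝ) ^ (j + 1)) ^ α := by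
    rw [← Real.rpow_pow_comm (by norm_num), pow_succ, ← mul_assoc, mul_comm, ← mul_assoc,
      ← Real.mul_rpow (by norm_num) (by norm_num)]
    norm_num
  rw [h1]
  gcongr

theorem tendsto_floor_two_pow_mul (t : ℝ) :
    Tendsto (fun j : ℕ => (2⁻¹ : ℝ) ^ j * ⌊(2 : ℝ) ^ j * t⌋) atTop (𝓝 t) := by
  have h0 : Tendsto (fun j : ℕ => (2⁻¹ : ℝ) ^ j) atTop (𝓝 0) :=
    tendsto_pow_atTop_nhds_zero_of_lt_one (by norm_num) (by norm_num)
  have hp : ∀ j : ℕ, (2⁻¹ : ℝ) ^ j * (2 ^ j * t) = t := fun j => by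
    rw [← mul_assoc, ← mul_pow]; norm_num
  refine tendsto_of_tendsto_of_tendsto_of_le_of_le (g := fun j : ℕ => t - (2⁻¹ : ℝ) ^ j)
    (h := fun _ => t) (by simpa using h0.const_sub t) tendsto_const_nhds (fun j => ?_) (fun j => ?_)
  · have := mul_le_mul_of_nonneg_left (Int.lt_floor_add_one ((2 : ℝ) ^ j * t)).le
      (by positivity : (0 : ℝ) ≤ 2⁻¹ ^ j)
    rw [hp] at this
    simp only
    linarith
  · have := mul_le_mul_of_nonneg_left (Int.floor_le ((2 : ℝ) ^ j * t))
      (by positivity : (0 : ℝ) ≤ 2⁻¹ ^ j)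
    rwa [hp] at this

theorem abs_sum_sub_le {x : ℤ → ℝ} {c B : ℝ} {i : ℤ} (n : ℕ)
    (h : ∀ m : ℕ, m < n → |Δ x (i + m) - c| ≤ B) : |x (i + n) - x i - n * c| ≤ n * B := by
  induction n with
  | zero => simp
  | succ n ih =>
    have h1 := ih fun m hm => h m (by omega)
    have h2 := h n (by omega)
    have h3 := abs_add_le (x (i + n) - x i - n * c) (Δ x (i + n) - c)
    have h4 : x (i + (n + 1 : ℕ)) - x i - (n + 1 : ℕ) * c
        = x (i + n) - x i - n * c + (Δ x (i + n) - c) := by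
      simp only [Δ]; push_cast; rw [add_assoc]; ring
    rw [h4]
    push_cast
    linarith

/-- If the scaled differences of `z` converge to `G`, then `G` controls the increments of the
limit `F` of `z`. -/
theorem dyadic_limit_increment {z : ℕ → ℤ → ℝ} {F G : ℝ → ℝ} {b : ℕ → ℝ}
    (hF : ∀ t, Tendsto (fun j => z j ⌊(2 : ℝ) ^ j * t⌋) atTop (𝓝 (F t)))
    (hb : Tendsto b atTop (𝓝 0))
    (hG : ∀ j t, |G t - 2 ^ j * Δ (z j) ⌊(2 : ℝ) ^ j * t⌋| ≤ b j) {t u c ε : ℝ} (htu : t ≤ u)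
    (hc : ∀ x, t ≤ x → x ≤ u → |G x - c| ≤ ε) :
    |F u - F t - (u - t) * c| ≤ (u - t) * ε := by
  have hlen := (tendsto_floor_two_pow_mul u).sub (tendsto_floor_two_pow_mul t)
  have h1 : Tendsto (fun j : ℕ => |z j ⌊(2 : ℝ) ^ j * u⌋ - z j ⌊(2 : ℝ) ^ j * t⌋ -
      ((2⁻¹ : ℝ) ^ j * ⌊(2 : ℝ) ^ j * u⌋ - (2⁻¹ : ℝ) ^ j * ⌊(2 : ℝ) ^ j * t⌋) * c|) atTop
      (𝓝 |F u - F t - (u - t) * c|) :=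
    (((hF u).sub (hF t)).sub (hlen.mul_const c)).abs
  have h2 : Tendsto (fun j : ℕ =>
      ((2⁻¹ : ℝ) ^ j * ⌊(2 : ℝ) ^ j * u⌋ - (2⁻¹ : ℝ) ^ j * ⌊(2 : ℝ) ^ j * t⌋) * (ε + b j)) atTop
      (𝓝 ((u - t) * ε)) := by
    simpa using hlen.mul (hb.const_add ε)
  refine le_of_tendsto_of_tendsto' h1 h2 fun j => ?_
  set i := ⌊(2 : ℝ) ^ j * t⌋ with hi
  set l := ⌊(2 : ℝ) ^ j * u⌋ with hl
  have hp : (0 : ℝ) < 2 ^ j := by positivity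
  have hil : i ≤ l := Int.floor_le_floor (by gcongr)
  obtain ⟨n, hn⟩ : ∃ n : ℕ, l = i + n := ⟨(l - i).toNat, by omega⟩
  have key : ∀ m : ℕ, m < n →
      |Δ (z j) (i + m) - (2⁻¹ : ℝ) ^ j * c| ≤ (2⁻¹ : ℝ) ^ j * (ε + b j) := by
    intro m hm
    have hx : ∃ x, t ≤ x ∧ x ≤ u ∧ ⌊(2 : ℝ) ^ j * x⌋ = i + m := by
      rcases Nat.eq_zero_or_pos m with rfl | hm0
      · exact ⟨t, le_rfl, htu, by simp [hi]⟩
      · have e : (2 : ℝ) ^ j * (((i + m : ℤ) : ℝ) / 2 ^ j) = ((i + m : ℤ) : ℝ) := by field_simp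
        refine ⟨((i + m : ℤ) : ℝ) / 2 ^ j, ?_, ?_, by rw [e, Int.floor_intCast]⟩
        · rw [le_div_iff₀ hp, mul_comm]
          have h3 := (Int.lt_floor_add_one ((2 : ℝ) ^ j * t)).le
          have h4 : i + 1 ≤ i + m := by omega
          have h5 : ((i + 1 : ℤ) : ℝ) ≤ ((i + m : ℤ) : ℝ) := by exact_mod_cast h4
          rw [← hi] at h3
          push_cast at h5 ⊢
          linarith
        · rw [div_le_iff₀ hp, mul_comm u]
          have h3 := Int.floor_le ((2 : ℝ) ^ j * u)
          have h4 : i + m ≤ l := by omega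
          have h5 : ((i + m : ℤ) : ℝ) ≤ ((l : ℤ) : ℝ) := by exact_mod_cast h4
          rw [← hl] at h3
          linarith
    obtain ⟨x, hx1, hx2, hx3⟩ := hx
    have h3 := hc x hx1 hx2
    have h4 := hG j x
    rw [hx3, abs_sub_comm] at h4
    have h5 := abs_add_le (2 ^ j * Δ (z j) (i + m) - G x) (G x - c)
    rw [sub_add_sub_cancel] at h5
    have h6 : Δ (z j) (i + m) - (2⁻¹ : ℝ) ^ j * c
        = (2⁻¹ : ℝ) ^ j * (2 ^ j * Δ (z j) (i + m) - c) := by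
      rw [inv_pow]; field_simp
    rw [h6, abs_mul, abs_of_pos (by positivity : (0 : ℝ) < 2⁻¹ ^ j)]
    gcongr
    linarith
  have h3 := abs_sum_sub_le n key
  have h4 : (2⁻¹ : ℝ) ^ j * l - (2⁻¹ : ℝ) ^ j * i = n * (2⁻¹ : ℝ) ^ j := by
    rw [hn]; push_cast; ring
  rw [h4, hn, mul_assoc, mul_assoc]
  exact h3

theorem hasDerivAt_dyadic_limit {z : ℕ → ℤ → ℝ} {F G : ℝ → ℝ} {b : ℕ → ℝ}
    (hF : ∀ t, Tendsto (fun j => z j ⌊(2 : ℝ) ^ j * t⌋) atTop (𝓝 (F t)))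
    (hb : Tendsto b atTop (𝓝 0))
    (hG : ∀ j t, |G t - 2 ^ j * Δ (z j) ⌊(2 : ℝ) ^ j * t⌋| ≤ b j) (hGc : Continuous G) (t : ℝ) :
    HasDerivAt F (G t) t := by
  rw [hasDerivAt_iff_isLittleO, Asymptotics.isLittleO_iff]
  intro ε hε
  obtain ⟨r, hr, hball⟩ := Metric.continuous_iff.1 hGc t ε hε
  filter_upwards [Metric.ball_mem_nhds t hr] with u hu
  rw [Metric.mem_ball, Real.dist_eq] at hu
  rw [Real.norm_eq_abs, Real.norm_eq_abs, smul_eq_mul]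
  have hclose : ∀ x, |x - t| ≤ |u - t| → |G x - G t| ≤ ε := fun x hx =>
    (hball x (hx.trans_lt hu)).le
  rcases le_total t u with h | h
  · have := dyadic_limit_increment hF hb hG h (c := G t) (ε := ε) fun x h1 h2 => hclose x (by
      rw [abs_of_nonneg (by linarith), abs_of_nonneg (by linarith)]; linarith)
    rw [abs_of_nonneg (sub_nonneg.2 h)]
    linarith
  · have := dyadic_limit_increment hF hb hG h (c := G t) (ε := ε) fun x h1 h2 => hclose x (by
      rw [abs_of_nonpos (by linarith), abs_of_nonpos (by linarith)]; linarith)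
    rw [abs_of_nonpos (sub_nonpos.2 h), ← abs_neg]
    rw [show -(F u - F t - (u - t) * G t) = F t - F u - (t - u) * G t by ring]
    linarith

theorem contDiff_succ_of_hasDerivAt {n : ℕ} {f f' : ℝ → ℝ} (h : ∀ t, HasDerivAt f (f' t) t)
    (hf' : ContDiff ℝ n f') : ContDiff ℝ (n + 1) f := by
  rw [contDiff_succ_iff_deriv]
  refine ⟨fun t => (h t).differentiableAt, by simp, ?_⟩
  rwa [show deriv f = f' from funext fun t => (h t).deriv]

/-- Smoothness of the limit of dyadic data with controlled scaled differences. -/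
theorem contDiff_three_of_scaled_differences {x : ℕ → ℤ → ℝ} {C θ : ℝ} (hθ0 : 0 ≤ θ) (hθ : θ < 1)
    (hstep : ∀ k ≤ 3, ∀ j K, |(2 : ℝ) ^ (k * (j + 1)) * Δ^[k] (x (j + 1)) K
      - 2 ^ (k * j) * Δ^[k] (x j) (K / 2)| ≤ C * θ ^ j)
    (hΔ : ∀ k ≤ 3, ∀ j i, 2 ^ (k * j) * |Δ^[k + 1] (x j) i| ≤ C * θ ^ j)
    {φ : ℝ → ℝ} (hφ : ∀ t, Tendsto (fun j => x j ⌊(2 : ℝ) ^ j * t⌋) atTop (𝓝 (φ t))) :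
    ContDiff ℝ 3 φ ∧ ∃ D, 0 ≤ D ∧ ∀ (j : ℕ) (t u : ℝ), |t - u| ≤ (2⁻¹ : ℝ) ^ j →
      |deriv (deriv (deriv φ)) t - deriv (deriv (deriv φ)) u| ≤ D * θ ^ j := by
  have hC : 0 ≤ C := by simpa using (abs_nonneg _).trans (hstep 0 (by norm_num) 0 0)
  set z : ℕ → ℕ → ℤ → ℝ := fun k j i => 2 ^ (k * j) * Δ^[k] (x j) i with hz
  have hex : ∀ k, ∃ F : ℝ → ℝ, k ≤ 3 →
      ∀ j t, |F t - z k j ⌊(2 : ℝ) ^ j * t⌋| ≤ C * θ ^ j / (1 - θ) := by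
    intro k
    by_cases hk : k ≤ 3
    · obtain ⟨F, hF⟩ := exists_dyadic_limit hθ (z := z k) (hstep k hk)
      exact ⟨F, fun _ => hF⟩
    · exact ⟨0, fun h => absurd h hk⟩
  choose F hF using hex
  have hb : Tendsto (fun j : ℕ => C * θ ^ j / (1 - θ)) atTop (𝓝 0) := by
    simpa using ((tendsto_pow_atTop_nhds_zero_of_lt_one hθ0 hθ).const_mul C).div_const (1 - θ)
  have hzΔ : ∀ k j i, Δ (z k j) i = 2 ^ (k * j) * Δ^[k + 1] (x j) i := by
    intro k j i
    rw [Function.iterate_succ_apply']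
    simp only [hz, Δ_mul_left]
  have hmod : ∀ k ≤ 3, ∀ (j : ℕ) (t u : ℝ), |t - u| ≤ (2⁻¹ : ℝ) ^ j →
      |F k t - F k u| ≤ (2 * (C / (1 - θ)) + C) * θ ^ j := by
    intro k hk
    refine dyadic_limit_modulus (z := z k) (fun j i => ?_) (fun j t => ?_)
    · rw [hzΔ, abs_mul, abs_of_pos (by positivity)]
      exact hΔ k hk j i
    · rw [div_mul_eq_mul_div]
      exact hF k hk j t
  have hcont : ∀ k ≤ 3, Continuous (F k) := fun k hk =>
    continuous_of_dyadic_modulus hθ0 hθ (hmod k hk)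
  have hlim : ∀ k ≤ 3, ∀ t, Tendsto (fun j => z k j ⌊(2 : ℝ) ^ j * t⌋) atTop (𝓝 (F k t)) := by
    intro k hk t
    rw [tendsto_iff_dist_tendsto_zero]
    refine squeeze_zero (fun _ => dist_nonneg) (fun j => ?_) hb
    rw [dist_comm]
    exact hF k hk j t
  have hder : ∀ k < 3, ∀ t, HasDerivAt (F k) (F (k + 1) t) t := by
    intro k hk
    refine hasDerivAt_dyadic_limit (hlim k hk.le) hb (fun j t => ?_) (hcont (k + 1) hk)
    rw [hzΔ, ← mul_assoc, ← pow_add, show j + k * j = (k + 1) * j by ring]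
    exact hF (k + 1) hk j t
  have hφ0 : φ = F 0 := by
    funext t
    refine tendsto_nhds_unique (hφ t) ?_
    simpa [hz] using hlim 0 (by norm_num) t
  have hd : ∀ k < 3, deriv (F k) = F (k + 1) := fun k hk => funext fun t => (hder k hk t).deriv
  rw [hφ0, hd 0 (by norm_num), hd 1 (by norm_num), hd 2 (by norm_num)]
  have h1θ : 0 < 1 - θ := sub_pos.2 hθ
  refine ⟨?_, 2 * (C / (1 - θ)) + C, by positivity, hmod 3 le_rfl⟩
  have c3 : ContDiff ℝ (0 : ℕ) (F 3) := contDiff_zero.2 (hcont 3 le_rfl)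
  have c2 : ContDiff ℝ (1 : ℕ) (F 2) := by
    simpa using contDiff_succ_of_hasDerivAt (hder 2 (by norm_num)) c3
  have c1 : ContDiff ℝ (2 : ℕ) (F 1) := by
    simpa [one_add_one_eq_two] using contDiff_succ_of_hasDerivAt (hder 1 (by norm_num)) c2
  simpa [two_add_one_eq_three] using contDiff_succ_of_hasDerivAt (hder 0 (by norm_num)) c1

end DyadicLimits

section Recursion

open Filter Topology

theorem exists_geometric_bound {x : ℕ → ℤ → ℝ} {r ρ B E : ℝ} (hr : 0 ≤ r) (hρ : r < ρ)
    (h0 : ∀ i, |x 0 i| ≤ B)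
    (hstep : ∀ n b, (∀ i, |x n i| ≤ b) → ∀ i, |x (n + 1) i| ≤ r * b + E * ρ ^ n) :
    ∃ C, 0 ≤ C ∧ ∀ n i, |x n i| ≤ C * ρ ^ n := by
  have hB : 0 ≤ B := (abs_nonneg _).trans (h0 0)
  have hd : 0 < ρ - r := sub_pos.2 hρ
  have hρ0 : 0 < ρ := hr.trans_lt hρ
  refine ⟨max B (E / (ρ - r)), le_max_of_le_left hB, fun n => ?_⟩
  induction n with
  | zero => exact fun i => by simpa using Or.inl (h0 i)
  | succ n ih =>
    intro i
    refine (hstep n _ ih i).trans ?_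
    have h1 : E ≤ max B (E / (ρ - r)) * (ρ - r) := (div_le_iff₀ hd).1 (le_max_right _ _)
    have h2 : E * ρ ^ n ≤ max B (E / (ρ - r)) * (ρ - r) * ρ ^ n := by gcongr
    rw [pow_succ]
    linarith

theorem abs_iterate_Δ_sub_le {q k : ℕ} {x y : ℤ → ℝ} {ε : ℝ}
    (h : ∀ K, |y K - S (q + k) x K| ≤ ε) (K : ℤ) :
    |Δ^[k] y K - (2⁻¹ : ℝ) ^ k * S q (Δ^[k] x) K| ≤ 2 ^ k * ε := by
  have h1 := congrFun (iterate_Δ_add k (S (q + k) x) (fun i => y i - S (q + k) x i)) K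
  simp only [add_sub_cancel] at h1
  have h2 := abs_iterate_Δ_le k (fun i => y i - S (q + k) x i) ε h K
  rw [h1, iterate_Δ_S]
  simpa using h2

theorem abs_iterate_Δ_le_of_residual {q k : ℕ} {x y : ℤ → ℝ} {b ε : ℝ}
    (h : ∀ K, |y K - S (q + k) x K| ≤ ε) (hx : ∀ i, |Δ^[k] x i| ≤ b) (K : ℤ) :
    |Δ^[k] y K| ≤ (2⁻¹ : ℝ) ^ k * b + 2 ^ k * ε := by
  have h1 := abs_iterate_Δ_sub_le h K
  have h2 : |S q (Δ^[k] x) K| ≤ b := abs_S_le _ _ _ _ fun l _ _ => hx l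
  have h3 := abs_add_le (Δ^[k] y K - (2⁻¹ : ℝ) ^ k * S q (Δ^[k] x) K)
    ((2⁻¹ : ℝ) ^ k * S q (Δ^[k] x) K)
  rw [sub_add_cancel, abs_mul, abs_of_pos (by positivity : (0 : ℝ) < 2⁻¹ ^ k)] at h3
  have h4 : (2⁻¹ : ℝ) ^ k * |S q (Δ^[k] x) K| ≤ (2⁻¹ : ℝ) ^ k * b := by gcongr
  linarith

/-- Data produced by a nonlinear perturbation of `S (r + 4)`, whose residual is controlled by first
and second differences, have a limit with almost Lipschitz third derivative. -/
theorem contDiff_three_of_residual {r : ℕ} {x : ℕ → ℤ → ℝ} {C δ₀ β : ℝ} (hC : 0 ≤ C)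
    (hres : ∀ n δ₁ δ₂, (∀ i, |Δ (x n) i| ≤ δ₁) → (∀ i, |Δ^[2] (x n) i| ≤ δ₂) → δ₁ ≤ δ₀ →
      ∀ K, |x (n + 1) K - S (r + 4) (x n) K| ≤ C * (δ₁ ^ 2 * (δ₂ + δ₁ ^ 2)))
    (h0 : ∀ i, |Δ (x 0) i| ≤ β) (hβ : 2 * β ≤ δ₀) (hβ1 : 2 * β ≤ 1) (hβC : 192 * C * β ^ 2 ≤ 1)
    {φ : ℝ → ℝ} (hφ : ∀ t, Tendsto (fun j => x j ⌊(2 : ℝ) ^ j * t⌋) atTop (𝓝 (φ t)))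
    {θ : ℝ} (hθ : 1 / 2 < θ) (hθ1 : θ < 1) :
    ContDiff ℝ 3 φ ∧ ∃ D, 0 ≤ D ∧ ∀ (j : ℕ) (t u : ℝ), |t - u| ≤ (2⁻¹ : ℝ) ^ j →
      |deriv (deriv (deriv φ)) t - deriv (deriv (deriv φ)) u| ≤ D * θ ^ j := by
  have hβ0 : 0 ≤ β := (abs_nonneg _).trans (h0 0)
  have hu : ∀ n : ℕ, 0 < (2⁻¹ : ℝ) ^ n ∧ (2⁻¹ : ℝ) ^ n ≤ 1 := fun n =>
    ⟨by positivity, pow_le_one₀ (by norm_num) (by norm_num)⟩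
  have weak : ∀ n, (∀ i, |Δ (x n) i| ≤ 2 * β * (2⁻¹ : ℝ) ^ n) → ∀ K,
      |x (n + 1) K - S (r + 4) (x n) K| ≤ 24 * C * β ^ 3 * ((2⁻¹ : ℝ) ^ n) ^ 3 := by
    intro n hn K
    obtain ⟨u0, u1⟩ := hu n
    set u := (2⁻¹ : ℝ) ^ n
    have h1 : 2 * β * u ≤ 2 * β := mul_le_of_le_one_right (by positivity) u1
    have h2 := hres n (2 * β * u) (2 ^ 1 * (2 * β * u)) hn
      (fun i => abs_iterate_Δ_le 1 (Δ (x n)) _ hn i) (h1.trans hβ) K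
    refine h2.trans ?_
    have h3 : (2 * β * u) ^ 2 ≤ 2 * β * u := by
      rw [sq]; exact mul_le_of_le_one_left (by positivity) (h1.trans hβ1)
    calc _ ≤ C * ((2 * β * u) ^ 2 * (2 ^ 1 * (2 * β * u) + 2 * β * u)) := by gcongr
      _ = _ := by ring
  have first' : ∀ n i, |Δ (x n) i| ≤ β * (2⁻¹ : ℝ) ^ n * (2 - (2⁻¹ : ℝ) ^ n) := by
    intro n
    induction n with
    | zero => intro i; have := h0 i; norm_num; exact this
    | succ n ih =>
      intro i
      have h1 := weak n fun i => (ih i).trans (by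
        obtain ⟨u0, u1⟩ := hu n
        have : 0 ≤ β * (2⁻¹ : ℝ) ^ n := by positivity
        nlinarith)
      have h2 := abs_iterate_Δ_le_of_residual (q := r + 3) (k := 1) h1 ih i
      refine h2.trans ?_
      obtain ⟨u0, u1⟩ := hu n
      rw [pow_succ (2⁻¹ : ℝ) n]
      set u := (2⁻¹ : ℝ) ^ n
      have h3 : 192 * C * β ^ 2 * (β * u ^ 3) ≤ 1 * (β * u ^ 3) := by gcongr
      have h4 : β * u ^ 3 ≤ β * u ^ 2 := by
        gcongr ?_ * ?_
        exact pow_le_pow_of_le_one u0.le u1 (by norm_num)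
      nlinarith
  have first : ∀ n i, |Δ (x n) i| ≤ 2 * β * (2⁻¹ : ℝ) ^ n := fun n i => (first' n i).trans (by
    obtain ⟨u0, u1⟩ := hu n
    have : 0 ≤ β * (2⁻¹ : ℝ) ^ n := by positivity
    nlinarith)
  have init : ∀ k i, |Δ^[k + 1] (x 0) i| ≤ 2 ^ k * β := fun k i =>
    abs_iterate_Δ_le k (Δ (x 0)) β h0 i
  obtain ⟨A, hA0, hA⟩ := exists_geometric_bound (x := fun n => Δ^[2] (x n)) (r := (2⁻¹ : ℝ) ^ 2)
    (ρ := θ / 2) (E := 2 ^ 2 * (24 * C * β ^ 3)) (by positivity) (by norm_num; linarith) (init 1)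
    (fun n b hb i => by
      refine (abs_iterate_Δ_le_of_residual (q := r + 2) (k := 2) (weak n (first n)) hb i).trans ?_
      have : ((2⁻¹ : ℝ) ^ n) ^ 3 ≤ (θ / 2) ^ n := by
        rw [← pow_mul, mul_comm, pow_mul]
        exact pow_le_pow_left₀ (by norm_num) (by norm_num; linarith) n
      rw [← mul_assoc (2 ^ 2 : ℝ)]
      gcongr)
  set E := C * (4 * β ^ 2 * (A + 4 * β ^ 2)) with hE
  have hE0 : 0 ≤ E := by positivity
  have strong : ∀ n K, |x (n + 1) K - S (r + 4) (x n) K| ≤ E * (θ / 8) ^ n := by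
    intro n K
    obtain ⟨u0, u1⟩ := hu n
    have h1 := hres n _ _ (first n) (hA n)
      ((mul_le_of_le_one_right (by positivity) u1).trans hβ) K
    refine h1.trans ?_
    have h2 : ((2⁻¹ : ℝ) ^ n) ^ 2 ≤ (θ / 2) ^ n := by
      rw [← pow_mul, mul_comm, pow_mul]
      exact pow_le_pow_left₀ (by norm_num) (by norm_num; linarith) n
    have h3 : (θ / 8) ^ n = ((2⁻¹ : ℝ) ^ n) ^ 2 * (θ / 2) ^ n := by
      rw [← pow_mul, mul_comm n, pow_mul, ← mul_pow]; congr 1; ring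
    calc _ ≤ C * ((2 * β * (2⁻¹ : ℝ) ^ n) ^ 2 * (A * (θ / 2) ^ n + 4 * β ^ 2 * (θ / 2) ^ n)) := by
          rw [mul_pow (2 * β), mul_pow 2 β]
          gcongr
          norm_num
      _ = _ := by rw [h3, hE]; ring
  have hdiff : ∀ k, ∃ B, 0 ≤ B ∧
      (k ≤ 3 → ∀ n i, |Δ^[k + 1] (x n) i| ≤ B * (2 * θ * 2⁻¹ ^ (k + 1)) ^ n) := by
    intro k
    by_cases hk : k ≤ 3
    · obtain ⟨B, hB0, hB⟩ := exists_geometric_bound (x := fun n => Δ^[k + 1] (x n))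
        (r := (2⁻¹ : ℝ) ^ (k + 1)) (ρ := 2 * θ * 2⁻¹ ^ (k + 1)) (E := 2 ^ (k + 1) * E)
        (by positivity) (lt_mul_of_one_lt_left (by positivity) (by linarith)) (init k)
        (fun n b hb i => by
          refine (abs_iterate_Δ_le_of_residual (q := r + 3 - k) (k := k + 1)
            (ε := E * (θ / 8) ^ n) ?_ hb i).trans ?_
          · rw [show r + 3 - k + (k + 1) = r + 4 by omega]
            exact strong n
          · have h1 : (2⁻¹ : ℝ) ^ 4 ≤ 2⁻¹ ^ (k + 1) :=
              pow_le_pow_of_le_one (by norm_num) (by norm_num) (by omega)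
            have h2 : θ / 8 ≤ 2 * θ * 2⁻¹ ^ (k + 1) := by
              norm_num at h1 ⊢; nlinarith
            rw [← mul_assoc (2 ^ (k + 1) : ℝ)]
            gcongr)
      exact ⟨B, hB0, fun _ => hB⟩
    · exact ⟨0, le_rfl, fun h => absurd h hk⟩
  choose B hB0 hB using hdiff
  set M := ∑ k ∈ Finset.range 4, B k with hM
  have hBM : ∀ k ≤ 3, B k ≤ M := fun k hk =>
    Finset.single_le_sum (f := B) (fun k _ => hB0 k) (Finset.mem_range.2 (by omega))
  have hM0 : 0 ≤ M := (hB0 0).trans (hBM 0 (by norm_num))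
  have hscaled : ∀ k ≤ 3, ∀ j i, 2 ^ (k * j) * |Δ^[k + 1] (x j) i| ≤ M * θ ^ j := by
    intro k hk j i
    have h1 : (2 : ℝ) ^ (k * j) * (2 * θ * 2⁻¹ ^ (k + 1)) ^ j = θ ^ j := by
      rw [pow_mul, ← mul_pow]
      congr 1
      rw [inv_pow, pow_succ]; field_simp
    calc _ ≤ (2 : ℝ) ^ (k * j) * (M * (2 * θ * 2⁻¹ ^ (k + 1)) ^ j) := by
          have h2 := hBM k hk
          have h3 := hB k hk j i
          gcongr
          exact h3.trans (by gcongr)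
      _ = M * ((2 : ℝ) ^ (k * j) * (2 * θ * 2⁻¹ ^ (k + 1)) ^ j) := by ring
      _ = _ := by rw [h1]
  have hθj : ∀ j : ℕ, 0 ≤ θ ^ j := fun j => pow_nonneg (by linarith) j
  refine contDiff_three_of_scaled_differences (C := 64 * E + (r + 4) * M + M) (by linarith) hθ1
    (fun k hk j K => ?_) (fun k hk j i => (hscaled k hk j i).trans ?_) hφ
  · have h1 := abs_iterate_Δ_sub_le (q := r + 4 - k) (k := k) (x := x j) (y := x (j + 1))
      (ε := E * (θ / 8) ^ j) (by
        rw [show r + 4 - k + k = r + 4 by omega]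
        exact strong j) K
    have h2 : |S (r + 4 - k) (Δ^[k] (x j)) K - Δ^[k] (x j) (K / 2)|
        ≤ ((r + 4 - k : ℕ) : ℝ) * (M * θ ^ j / 2 ^ (k * j)) := by
      refine abs_S_sub_le _ _ _ (fun i => ?_) K
      rw [← Function.iterate_succ_apply' Δ k, le_div_iff₀ (by positivity), mul_comm]
      exact hscaled k hk j i
    have hrk : ((r + 4 - k : ℕ) : ℝ) ≤ r + 4 := by exact_mod_cast Nat.sub_le _ _
    have e1 : (2 : ℝ) ^ (k * (j + 1)) * Δ^[k] (x (j + 1)) K - 2 ^ (k * j) * Δ^[k] (x j) (K / 2)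
        = 2 ^ (k * (j + 1)) *
            (Δ^[k] (x (j + 1)) K - (2⁻¹ : ℝ) ^ k * S (r + 4 - k) (Δ^[k] (x j)) K)
          + 2 ^ (k * j) * (S (r + 4 - k) (Δ^[k] (x j)) K - Δ^[k] (x j) (K / 2)) := by
      rw [mul_add k, mul_one, pow_add, inv_pow]; field_simp; ring
    rw [e1]
    refine (abs_add_le _ _).trans ?_
    rw [abs_mul, abs_mul, abs_of_pos (by positivity : (0 : ℝ) < 2 ^ (k * (j + 1))),
      abs_of_pos (by positivity : (0 : ℝ) < 2 ^ (k * j))]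
    have b1 : (2 : ℝ) ^ (k * (j + 1)) * (2 ^ k * (E * (θ / 8) ^ j)) ≤ 64 * E * θ ^ j := by
      have e2 : (2 : ℝ) ^ (k * (j + 1)) * (2 ^ k * (E * (θ / 8) ^ j))
          = (2 ^ k) ^ 2 * E * ((2 ^ k / 8) ^ j * θ ^ j) := by
        rw [← mul_pow, show (2 : ℝ) ^ k / 8 * θ = 2 ^ k * (θ / 8) by ring, mul_pow (2 ^ k : ℝ) (θ / 8),
          mul_add k, pow_add, pow_mul]
        ring
      have h8 : (2 : ℝ) ^ k ≤ 8 := by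
        calc (2 : ℝ) ^ k ≤ 2 ^ 3 := pow_le_pow_right₀ (by norm_num) hk
          _ = 8 := by norm_num
      have h64 : ((2 : ℝ) ^ k) ^ 2 ≤ 64 := by
        calc ((2 : ℝ) ^ k) ^ 2 ≤ 8 ^ 2 := by gcongr
          _ = 64 := by norm_num
      have h9 : ((2 : ℝ) ^ k / 8) ^ j ≤ 1 :=
        pow_le_one₀ (by positivity) ((div_le_one (by norm_num)).2 h8)
      have := hθj j
      rw [e2]
      calc _ ≤ 64 * E * (1 * θ ^ j) := by gcongr
        _ = _ := by ring
    have b2 : (2 : ℝ) ^ (k * j) * (((r + 4 - k : ℕ) : ℝ) * (M * θ ^ j / 2 ^ (k * j)))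
        ≤ (r + 4) * M * θ ^ j := by
      have e2 : (2 : ℝ) ^ (k * j) * (((r + 4 - k : ℕ) : ℝ) * (M * θ ^ j / 2 ^ (k * j)))
          = ((r + 4 - k : ℕ) : ℝ) * M * θ ^ j := by field_simp
      rw [e2]
      have := hθj j
      gcongr
    have b3 : 0 ≤ M * θ ^ j := mul_nonneg hM0 (hθj j)
    have c1 := mul_le_mul_of_nonneg_left h1 (by positivity : (0 : ℝ) ≤ 2 ^ (k * (j + 1)))
    have c2 := mul_le_mul_of_nonneg_left h2 (by positivity : (0 : ℝ) ≤ 2 ^ (k * j))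
    linarith
  · have := hθj j
    gcongr
    have : 0 ≤ (r + 4) * M := by positivity
    linarith

end Recursion

section MeshSize

open Filter Topology

theorem plin_eq_of_mem {j : ℕ} {x : ℤ → ℝ} {t : ℝ} {m : ℤ} (h0 : (m : ℝ) ≤ (2 : ℝ) ^ j * t)
    (h1 : (2 : ℝ) ^ j * t ≤ m + 1) : plin j x t = x m + ((2 : ℝ) ^ j * t - m) * Δ x m := by
  rcases h1.lt_or_eq with h1 | h1
  · have : ⌊(2 : ℝ) ^ j * t⌋ = m := Int.floor_eq_iff.2 ⟨h0, h1⟩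
    rw [plin, this, Δ]
  · have h2 : (2 : ℝ) ^ j * t = ((m + 1 : ℤ) : ℝ) := by rw [h1]; push_cast; ring
    have : ⌊(2 : ℝ) ^ j * t⌋ = m + 1 := by rw [h2, Int.floor_intCast]
    rw [plin, this, Δ, h2]
    push_cast; ring

theorem plin_grid (j : ℕ) (x : ℤ → ℝ) (i : ℤ) : plin j x ((2⁻¹ : ℝ) ^ j * i) = x i := by
  have h : (2 : ℝ) ^ j * ((2⁻¹ : ℝ) ^ j * i) = i := by
    rw [← mul_assoc, ← mul_pow]; norm_num
  rw [plin_eq_of_mem (m := i) h.ge (by rw [h]; linarith), h]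
  ring

theorem abs_plin_sub_floor_le (j : ℕ) (x : ℤ → ℝ) (t : ℝ) :
    |plin j x t - x ⌊(2 : ℝ) ^ j * t⌋| ≤ |Δ x ⌊(2 : ℝ) ^ j * t⌋| := by
  have h0 := Int.floor_le ((2 : ℝ) ^ j * t)
  have h1 := Int.lt_floor_add_one ((2 : ℝ) ^ j * t)
  rw [plin_eq_of_mem h0 h1.le, add_sub_cancel_left, abs_mul]
  refine mul_le_of_le_one_left (abs_nonneg _) ?_
  rw [abs_le]
  constructor <;> linarith

/-- Neighbouring grid points of level `j + n` lie in a common cell of level `j`. -/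
theorem abs_plin_grid_sub_le (j n : ℕ) (x : ℤ → ℝ) {B : ℝ} (h : ∀ m, |Δ x m| ≤ B) (i : ℤ) :
    |plin j x ((2⁻¹ : ℝ) ^ (j + n) * (i + 1 : ℤ)) - plin j x ((2⁻¹ : ℝ) ^ (j + n) * i)| ≤
      (2⁻¹ : ℝ) ^ n * B := by
  have hpos : (0 : ℤ) < 2 ^ n := by positivity
  set m := i / 2 ^ n with hm
  have h1 : m * 2 ^ n ≤ i := Int.ediv_mul_le _ hpos.ne'
  have h2 : i + 1 ≤ (m + 1) * 2 ^ n := Int.lt_ediv_add_one_mul_self _ hpos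
  have h1' : (m : ℝ) * 2 ^ n ≤ i := by exact_mod_cast h1
  have h2' : (i : ℝ) + 1 ≤ (m + 1) * 2 ^ n := by exact_mod_cast h2
  have hscale : ∀ y : ℝ, (2 : ℝ) ^ j * ((2⁻¹ : ℝ) ^ (j + n) * y) = (2⁻¹ : ℝ) ^ n * y := by
    intro y
    rw [pow_add, ← mul_assoc, ← mul_assoc, ← mul_pow]; norm_num
  have hinv : (2⁻¹ : ℝ) ^ n * 2 ^ n = 1 := by rw [← mul_pow]; norm_num
  have hp : (0 : ℝ) < (2⁻¹ : ℝ) ^ n := by positivity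
  have e1 := mul_le_mul_of_nonneg_left h1' hp.le
  have e2 := mul_le_mul_of_nonneg_left h2' hp.le
  have f1 : (2⁻¹ : ℝ) ^ n * (m * 2 ^ n) = m := by linear_combination (m : ℝ) * hinv
  have f2 : (2⁻¹ : ℝ) ^ n * ((m + 1) * 2 ^ n) = m + 1 := by
    linear_combination ((m : ℝ) + 1) * hinv
  rw [plin_eq_of_mem (m := m) (by rw [hscale]; push_cast; linarith)
      (by rw [hscale]; push_cast; linarith),
    plin_eq_of_mem (m := m) (by rw [hscale]; linarith) (by rw [hscale]; linarith),
    hscale, hscale]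
  rw [show ∀ a b c d e : ℝ, a + (b - c) * d - (a + (e - c) * d) = (b - e) * d by intros; ring,
    ← mul_sub, abs_mul]
  push_cast
  rw [add_sub_cancel_left, mul_one, abs_of_pos hp]
  exact mul_le_mul_of_nonneg_left (h m) hp.le

/-- Uniform convergence of the interpolants forces the mesh size to tend to zero. -/
theorem eventually_abs_Δ_le {L : ℝ} {N₀ : ℕ} (hN₀ : 1 ≤ N₀) {s : ℕ → ℤ → ℝ}
    (hmono : ∀ j, StrictMono (s j)) (hsper : ∀ (j : ℕ) (i : ℤ), s j (i + N₀ * 2 ^ j) = s j i + L)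
    {φ : ℝ → ℝ}
    (hconv : ∀ A : Set ℝ, IsCompact A → TendstoUniformlyOn (fun j => plin j (s j)) φ atTop A)
    {ε : ℝ} (hε : 0 < ε) : ∀ᶠ j in atTop, ∀ i, |Δ (s j) i| ≤ ε := by
  have hL : ∀ j i, |Δ (s j) i| ≤ L := by
    intro j i
    have h1 : s j (i + 1) ≤ s j (i + N₀ * 2 ^ j) := (hmono j).monotone (by
      have : (1 : ℤ) ≤ N₀ * 2 ^ j := by
        have : 0 < N₀ * 2 ^ j := by positivity
        exact_mod_cast this
      linarith)
    have h2 : s j i < s j (i + 1) := hmono j (by linarith)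
    rw [hsper] at h1
    rw [Δ, abs_of_pos (by linarith)]
    linarith
  obtain ⟨j₀, hj₀⟩ := eventually_atTop.1 (Metric.tendstoUniformlyOn_iff.1
    (hconv (Set.Icc 0 (N₀ : ℝ)) isCompact_Icc) (ε / 8) (by positivity))
  have hclose : ∀ j ≥ j₀, ∀ t ∈ Set.Icc 0 (N₀ : ℝ),
      |plin j (s j) t - plin j₀ (s j₀) t| ≤ ε / 4 := by
    intro j hj t ht
    have h1 := hj₀ j hj t ht
    have h2 := hj₀ j₀ le_rfl t ht
    rw [Real.dist_eq] at h1 h2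
    rw [abs_lt] at h1 h2
    rw [abs_le]
    constructor <;> linarith [h1.1, h1.2, h2.1, h2.2]
  have hlim : Tendsto (fun n : ℕ => (2⁻¹ : ℝ) ^ n * L) atTop (𝓝 0) := by
    simpa using (tendsto_pow_atTop_nhds_zero_of_lt_one (by norm_num : (0 : ℝ) ≤ 2⁻¹)
      (by norm_num)).mul_const L
  obtain ⟨n₀, hn₀⟩ := eventually_atTop.1 (hlim.eventually_lt_const (half_pos hε))
  refine eventually_atTop.2 ⟨j₀ + n₀, fun j hj => ?_⟩
  obtain ⟨n, rfl⟩ : ∃ n, j = j₀ + n := ⟨j - j₀, by omega⟩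
  have hperiodic : Function.Periodic (Δ (s (j₀ + n))) (N₀ * 2 ^ (j₀ + n) : ℤ) := by
    intro i
    rw [Δ, Δ, hsper, add_right_comm, hsper]
    ring
  have hP : (0 : ℤ) < N₀ * 2 ^ (j₀ + n) := by positivity
  intro i
  obtain ⟨i', ⟨hi0, hi1⟩, hi⟩ := hperiodic.exists_mem_Ico₀ hP i
  rw [hi]
  have hmem : ∀ k : ℤ, 0 ≤ k → k ≤ N₀ * 2 ^ (j₀ + n) →
      (2⁻¹ : ℝ) ^ (j₀ + n) * k ∈ Set.Icc 0 (N₀ : ℝ) := by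
    intro k h0 h1
    have h0' : (0 : ℝ) ≤ k := by exact_mod_cast h0
    have h1' : (k : ℝ) ≤ N₀ * 2 ^ (j₀ + n) := by exact_mod_cast h1
    refine ⟨by positivity, ?_⟩
    rwa [inv_pow, inv_mul_le_iff₀ (by positivity), mul_comm]
  have h1 := hclose _ (Nat.le_add_right j₀ n) _ (hmem i' hi0 hi1.le)
  have h2 := hclose _ (Nat.le_add_right j₀ n) _ (hmem (i' + 1) (by omega) hi1)
  have h3 := abs_plin_grid_sub_le j₀ n (s j₀) (hL j₀) i'
  have h4 := hn₀ n (by omega)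
  rw [plin_grid] at h1 h2
  rw [Δ]
  rw [abs_le] at *
  constructor <;> linarith [h1.1, h1.2, h2.1, h2.2, h3.1, h3.2]

/-- The values at the left grid points converge along with the interpolants. -/
theorem tendsto_floor_of_tendsto_plin {s : ℕ → ℤ → ℝ} {φ : ℝ → ℝ} {t : ℝ}
    (hφ : Tendsto (fun j => plin j (s j) t) atTop (𝓝 (φ t)))
    (hmesh : ∀ ε > 0, ∀ᶠ j in atTop, ∀ i, |Δ (s j) i| ≤ ε) :
    Tendsto (fun j => s j ⌊(2 : ℝ) ^ j * t⌋) atTop (𝓝 (φ t)) := by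
  have h : Tendsto (fun j => plin j (s j) t - s j ⌊(2 : ℝ) ^ j * t⌋) atTop (𝓝 0) := by
    rw [Metric.tendsto_nhds]
    intro ε hε
    filter_upwards [hmesh (ε / 2) (half_pos hε)] with j hj
    rw [Real.dist_eq, sub_zero]
    linarith [abs_plin_sub_floor_le j (s j) t, hj ⌊(2 : ℝ) ^ j * t⌋]
  simpa using hφ.sub h

end MeshSize

section Assembly

open Filter Topology

theorem dot_perp_self (w : ℝ × ℝ) : dot (perp w) w = 0 := by
  simp only [dot, perp]; ring

/-- One step of the normal transform deviates from linear subdivision by a higher-order term. -/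
theorem exists_step_bound (r : ℕ) {L : ℝ} (hL : 0 < L) {v : ℝ → ℝ × ℝ}
    (hper : ∀ t, v (t + L) = v t) (hreg : ContDiff ℝ 4 v)
    (hunit : ∀ t, dot (deriv v t) (deriv v t) = 1) :
    ∃ C δ₀ : ℝ, 0 ≤ C ∧ 0 < δ₀ ∧ ∀ (x y : ℤ → ℝ) (d : ℤ → ℝ), StrictMono x →
      (∀ K, v (y K) = S (r + 3) (fun k => v (x k)) K +
        d K • perp (S (r + 1) (Δ fun k => v (x k)) K)) →
      (∀ i K : ℤ, 2 * i ≤ K → K ≤ 2 * i + (r + 3 : ℕ) + 2 →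
        x i ≤ y K ∧ y K ≤ x (i + (r + 3 : ℕ) + 1)) →
      ∀ δ₁ δ₂, (∀ i, |Δ x i| ≤ δ₁) → (∀ i, |Δ^[2] x i| ≤ δ₂) → δ₁ ≤ δ₀ →
        ∀ K, |y K - S (r + 3) x K| ≤ C * (δ₁ ^ 2 * (δ₂ + δ₁ ^ 2)) := by
  obtain ⟨C, G₀, hC, hG₀, hres⟩ := exists_residual_bound r hL hper hreg hunit
  set P : ℝ := r + 4 with hP
  have hP1 : 1 ≤ P := by
    have : (0 : ℝ) ≤ r := r.cast_nonneg
    linarith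
  refine ⟨C * P ^ 4, G₀ / P, by positivity, by positivity, ?_⟩
  intro x y d hx hdata hloc δ₁ δ₂ h₁ h₂ hδ K
  have hδ₁ : 0 ≤ δ₁ := (abs_nonneg _).trans (h₁ 0)
  have hδ₂ : 0 ≤ δ₂ := (abs_nonneg _).trans (h₂ 0)
  have hlen : x (K / 2 + (r + 3 : ℕ) + 1) - x (K / 2) ≤ P * δ₁ := by
    have h := (abs_le.1 (abs_sub_le_of_abs_Δ_le x δ₁ h₁ (K / 2) (r + 4))).2
    rw [show K / 2 + (r + 3 : ℕ) + 1 = K / 2 + (r + 4 : ℕ) by push_cast; ring]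
    push_cast at h ⊢
    exact h
  have hst := S_mem_stencil (r + 3) hx.monotone K
  have hend : x ((K + (r + 3 : ℕ)) / 2) ≤ x (K / 2 + (r + 3 : ℕ) + 1) :=
    hx.monotone (by omega)
  have hyK := hloc (K / 2) K (by omega) (by omega)
  have horth : dot (v (y K) - S (r + 3) (fun k => v (x k)) K)
      (S (r + 1) (Δ fun k => v (x k)) K) = 0 := by
    have h0 := dot_perp_self (S (r + 1) (Δ fun k => v (x k)) K)
    rw [hdata K, add_sub_cancel_left]
    simp only [dot, Prod.smul_fst, Prod.smul_snd, smul_eq_mul] at h0 ⊢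
    linear_combination d K * h0
  have key := hres x hx K (y K) (P * δ₁) δ₂ h₂
    (by rw [mul_comm]; exact (le_div_iff₀ (by positivity)).1 hδ)
    (by rw [abs_le]; constructor <;> linarith [hyK.1, hyK.2, hst.1, hst.2])
    (by linarith) horth
  refine key.trans ?_
  rw [mul_assoc]
  refine mul_le_mul_of_nonneg_left ?_ hC
  have hP2 : 1 ≤ P ^ 2 := one_le_pow₀ hP1
  have : (P * δ₁) ^ 2 * (δ₂ + (P * δ₁) ^ 2) ≤ (P * δ₁) ^ 2 * (P ^ 2 * δ₂ + (P * δ₁) ^ 2) := by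
    gcongr
    exact le_mul_of_one_le_left hδ₂ hP2
  refine this.trans (le_of_eq ?_)
  ring

theorem deriv_three_comp_mul_left (c : ℝ) (φ : ℝ → ℝ) :
    deriv (deriv (deriv fun t => φ (c * t))) =
      fun t => c ^ 3 * deriv (deriv (deriv φ)) (c * t) := by
  have key : ∀ (a : ℝ) (f : ℝ → ℝ),
      deriv (fun t => a * f (c * t)) = fun t => (a * c) * deriv f (c * t) := by
    intro a f
    funext t
    rw [deriv_const_mul_field, deriv_comp_mul_left, smul_eq_mul, mul_assoc]
  have h := key 1 φ
  simp only [one_mul] at h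
  rw [h, key, key]
  funext t
  ring

/-- A continuous function with a local Hölder modulus is Hölder on compact intervals. -/
theorem exists_holder_Icc {F : ℝ → ℝ} (hF : Continuous F) {C c α : ℝ} (hC : 0 ≤ C) (hc : 0 < c)
    (hα : 0 < α) (h : ∀ t u, c * |t - u| ≤ 1 → |F t - F u| ≤ C * (c * |t - u|) ^ α) (a b : ℝ) :
    ∃ D : ℝ, ∀ t ∈ Set.Icc a b, ∀ u ∈ Set.Icc a b, |F t - F u| ≤ D * |t - u| ^ α := by
  obtain ⟨B, hB⟩ := isCompact_Icc.exists_bound_of_continuousOn (hF.continuousOn (s := Set.Icc a b))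
  refine ⟨(C + 2 * B) * c ^ α, fun t ht u hu => ?_⟩
  have hBt := hB t ht
  have hBu := hB u hu
  have hB0 : 0 ≤ B := (norm_nonneg _).trans hBt
  rw [Real.norm_eq_abs] at hBt hBu
  rw [mul_assoc, ← Real.mul_rpow hc.le (abs_nonneg _), add_mul]
  have hnn : 0 ≤ (c * |t - u|) ^ α := by positivity
  rcases le_or_gt (c * |t - u|) 1 with h1 | h1
  · have := h t u h1
    have : 0 ≤ 2 * B * (c * |t - u|) ^ α := by positivity
    linarith
  · have h2 : 1 ≤ (c * |t - u|) ^ α := Real.one_le_rpow h1.le hα.le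
    have h3 : 2 * B ≤ 2 * B * (c * |t - u|) ^ α := le_mul_of_one_le_right (by positivity) h2
    have h4 : 0 ≤ C * (c * |t - u|) ^ α := by positivity
    have h5 := abs_sub (F t) (F u)
    linarith

end Assembly

/-- Theorem 3.2: for `p ≥ 4` and a simple closed `C⁴` arc-length curve, a well-posed and
convergent `(S_p, S_{p−2})` normal multiscale transform (normals generated by
`S_{p−2}(Δ v∘s^{j−1})`) has a `C^{3,1−}` normal re-parametrization: the limit `s(t)` is
three times continuously differentiable and `s'''` is `α`-Hölder on every compact interval
for every `α < 1`. -/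
theorem Sp_Spm2_normal_MT_smoothness (p : ℕ) (hp : 4 ≤ p)
    (L : ℝ) (hL : 0 < L) (v : ℝ → ℝ × ℝ) (hper : ∀ t, v (t + L) = v t)
    (hreg : ContDiff ℝ 4 v) (hunit : ∀ t, dot (deriv v t) (deriv v t) = 1)
    (hsimple : Set.InjOn v (Set.Ico 0 L))
    (N₀ : ℕ) (hN₀ : 1 ≤ N₀)
    (s : ℕ → ℤ → ℝ) (hmono : ∀ j, StrictMono (s j))
    (hsper : ∀ (j : ℕ) (i : ℤ), s j (i + N₀ * 2 ^ j) = s j i + L)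
    (d : ℕ → ℤ → ℝ)
    (hdata : ∀ j : ℕ, 1 ≤ j → ∀ K : ℤ,
      S (p - 2) (Δ fun k => v (s (j - 1) k)) K ≠ 0 ∧
      v (s j K) = S p (fun k => v (s (j - 1) k)) K +
        (d j K / enorm2 (S (p - 2) (Δ fun k => v (s (j - 1) k)) K)) •
          perp (S (p - 2) (Δ fun k => v (s (j - 1) k)) K))
    (hloc : ∀ j : ℕ, 1 ≤ j → ∀ i K : ℤ, 2 * i ≤ K → K ≤ 2 * i + p + 2 →
      s (j - 1) i ≤ s j K ∧ s j K ≤ s (j - 1) (i + p + 1))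
    (slim : ℝ → ℝ)
    (hconv : ∀ A : Set ℝ, IsCompact A →
      TendstoUniformlyOn (fun j => plin j (s j)) slim Filter.atTop A) :
    ContDiff ℝ 3 slim ∧
    ∀ α : ℝ, 0 < α → α < 1 → ∀ a b : ℝ, ∃ C : ℝ,
      ∀ t ∈ Set.Icc a b, ∀ u ∈ Set.Icc a b,
        |deriv (deriv (deriv slim)) t - deriv (deriv (deriv slim)) u| ≤ C * |t - u| ^ α := by
  obtain ⟨r, rfl⟩ : ∃ r, p = r + 4 := ⟨p - 4, by omega⟩
  obtain ⟨C, δ₀, hC, hδ₀, hstep⟩ := exists_step_bound (r + 1) hL hper hreg hunit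
  have hmesh : ∀ ε > 0, ∀ᶠ j in Filter.atTop, ∀ i, |Δ (s j) i| ≤ ε := fun ε hε =>
    eventually_abs_Δ_le hN₀ hmono hsper hconv hε
  set β : ℝ := min (δ₀ / 2) (min (1 / 2) (1 / (192 * C + 1))) with hβ
  have hβ0 : 0 < β := lt_min (by positivity) (lt_min (by norm_num) (by positivity))
  have hβδ : β ≤ δ₀ / 2 := min_le_left _ _
  have hβ1 : β ≤ 1 / 2 := (min_le_right _ _).trans (min_le_left _ _)
  have hβC : 192 * C * β ^ 2 ≤ 1 := by
    have h1 : β ≤ 1 / (192 * C + 1) := (min_le_right _ _).trans (min_le_right _ _)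
    rw [le_div_iff₀ (by positivity)] at h1
    nlinarith [mul_nonneg hC hβ0.le]
  obtain ⟨J, hJ⟩ := (hmesh β hβ0).exists
  have hres : ∀ n δ₁ δ₂, (∀ i, |Δ (s (J + n)) i| ≤ δ₁) → (∀ i, |Δ^[2] (s (J + n)) i| ≤ δ₂) →
      δ₁ ≤ δ₀ → ∀ K, |s (J + (n + 1)) K - S (r + 4) (s (J + n)) K| ≤
        C * (δ₁ ^ 2 * (δ₂ + δ₁ ^ 2)) := fun n =>
    hstep (s (J + n)) (s (J + (n + 1))) _ (hmono _)
      (fun K => (hdata (J + (n + 1)) (by omega) K).2)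
      (hloc (J + (n + 1)) (by omega))
  set c : ℝ := 2 ^ J with hc
  have hc0 : 0 < c := by positivity
  have hφ : ∀ t, Filter.Tendsto (fun n => s (J + n) ⌊(2 : ℝ) ^ n * t⌋) Filter.atTop
      (nhds (slim (c⁻¹ * t))) := by
    intro t
    have h1 := tendsto_floor_of_tendsto_plin
      ((hconv {c⁻¹ * t} isCompact_singleton).tendsto_at rfl) hmesh
    refine (h1.comp (Filter.tendsto_add_atTop_nat J)).congr fun n => ?_
    have : (2 : ℝ) ^ (n + J) * (c⁻¹ * t) = 2 ^ n * t := by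
      rw [pow_add, ← hc]; field_simp
    simp only [Function.comp_apply]
    rw [this, add_comm n J]
  have main := fun {θ : ℝ} (h : 1 / 2 < θ) (h' : θ < 1) =>
    contDiff_three_of_residual (x := fun n => s (J + n)) hC hres hJ (by linarith) (by linarith)
      hβC hφ h h'
  have hslim : slim = fun t => (fun u => slim (c⁻¹ * u)) (c * t) := by
    funext t
    simp only [inv_mul_cancel_left₀ hc0.ne']
  have hderiv : deriv (deriv (deriv slim)) = fun t =>
      c ^ 3 * deriv (deriv (deriv fun u => slim (c⁻¹ * u))) (c * t) := by
    conv_lhs => rw [hslim]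
    exact deriv_three_comp_mul_left c fun u => slim (c⁻¹ * u)
  have hsmooth : ContDiff ℝ 3 slim := by
    rw [hslim]
    exact (main (θ := 3 / 4) (by norm_num) (by norm_num)).1.comp (contDiff_const.mul contDiff_id)
  refine ⟨hsmooth, fun α hα0 hα1 a b => ?_⟩
  obtain ⟨-, D, hD, hmod⟩ := main (θ := (2⁻¹ : ℝ) ^ α)
    (by simpa using Real.rpow_lt_rpow_of_exponent_gt (by norm_num : (0 : ℝ) < 2⁻¹)
          (by norm_num) hα1)
    (Real.rpow_lt_one (by norm_num) (by norm_num) hα0)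
  have hcont : Continuous (deriv (deriv (deriv slim))) := by
    simpa [iteratedDeriv_succ, iteratedDeriv_zero] using hsmooth.continuous_iteratedDeriv 3 le_rfl
  refine exists_holder_Icc hcont (C := c ^ 3 * (D * 2 ^ α)) (c := c) (by positivity) hc0 hα0
    (fun t u htu => ?_) a b
  have habs : |c * t - c * u| = c * |t - u| := by rw [← mul_sub, abs_mul, abs_of_pos hc0]
  rw [hderiv, ← mul_sub, abs_mul, abs_of_pos (by positivity : 0 < c ^ 3), mul_assoc (c ^ 3),
    ← habs]
  exact mul_le_mul_of_nonneg_left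
    (holder_of_dyadic_modulus hD hα0 hmod (by rwa [habs])) (by positivity)
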